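/- In the ring of Hahn series over the reals with exponents in the nonpositive rationals, the element 1 + Σ_{n≥1} t^{−1/n} (i.e., the series with coefficient 1 at each exponent −1/n for n ≥ 1 and at 0) is a prime element. -/

import Mathlib

open Classical

/-- Degrees: Cantor normal forms with the natural sum. -/
abbrev Deg : Type 1 := Colex (Ordinal.{0} →₀ ℕ)

namespace Deg

noncomputable instance : One Deg := ⟨toColex (Finsupp.single 0 1)⟩

theorem one_def : (1 : Deg) = toColex (Finsupp.single 0 1) := rfl

theorem le_of_coeff_le {a b : Deg} (h : ∀ j, ofColex a j ≤ ofColex b j) : a ≤ b :=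
  Finsupp.toColex_monotone (a := ofColex a) (b := ofColex b) h

theorem lt_iff {a b : Deg} :
    a < b ↔ ∃ i, (∀ j, i < j → ofColex a j = ofColex b j) ∧ ofColex a i < ofColex b i :=
  Finsupp.Colex.lt_iff

theorem add_coeff (a b : Deg) (j : Ordinal.{0}) :
    ofColex (a + b) j = ofColex a j + ofColex b j := rfl

theorem nonneg (a : Deg) : 0 ≤ a := le_of_coeff_le fun _ => Nat.zero_le _

theorem one_coeff (j : Ordinal.{0}) : ofColex (1 : Deg) j = if j = 0 then 1 else 0 := by
  rw [one_def]; simp [Finsupp.single_apply, eq_comm]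

theorem zero_lt_one : (0 : Deg) < 1 :=
  lt_iff.2 ⟨0, fun j hj => by rw [one_coeff, if_neg hj.ne']; rfl,
    by rw [one_coeff, if_pos rfl]; exact Nat.one_pos⟩

theorem lt_add_one (a : Deg) : a < a + 1 := by
  simpa using add_lt_add_right zero_lt_one a

theorem lt_add_one_iff {a b : Deg} : a < b + 1 ↔ a ≤ b := by
  refine ⟨fun h => ?_, fun h => h.trans_lt (lt_add_one b)⟩
  obtain ⟨i, h1, h2⟩ := lt_iff.1 h
  simp only [add_coeff, one_coeff] at h1 h2
  by_cases hi : i = 0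
  · subst hi
    refine le_of_coeff_le fun j => ?_
    rcases eq_or_ne j 0 with rfl | hj
    · simp at h2; omega
    · have := h1 j (pos_iff_ne_zero.2 hj)
      rw [if_neg hj] at this; omega
  · refine (lt_iff.2 ⟨i, fun j hj => ?_, by simpa [hi] using h2⟩).le
    have := h1 j hj
    rw [if_neg (zero_le.trans_lt hj).ne'] at this; omega

theorem add_one_le_iff {a b : Deg} : a + 1 ≤ b ↔ a < b := by
  rw [← not_lt, lt_add_one_iff, not_le]

theorem exists_lt_of_lt_add {a b c : Deg} (h : a < b + c) :
    (∃ b' < b, a ≤ b' + c) ∨ ∃ c' < c, a ≤ b + c' := by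
  have key : ∀ b c : Deg, ∀ i, (∀ j, i < j → ofColex a j = ofColex (b + c) j) →
      ofColex a i < ofColex (b + c) i → 0 < ofColex b i → ∃ b' < b, a ≤ b' + c := by
    intro b c i h1 h2 hb
    let f : Ordinal.{0} → ℕ := fun j =>
      if i < j then ofColex b j else if j = i then ofColex b i - 1 else ofColex a j
    have hf : f.support ⊆ ((ofColex b).support ∪ (ofColex a).support : Finset _) := by
      intro j hj
      simp only [Finset.coe_union, Set.mem_union, Finset.mem_coe, Finsupp.mem_support_iff]
      by_contra! hh
      apply hj
      simp only [f]
      split_ifs with h3 h4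
      · exact hh.1
      · subst h4; omega
      · exact hh.2
    let b' : Deg := toColex (Finsupp.ofSupportFinite f ((Finset.finite_toSet _).subset hf))
    have hb' : ∀ j, ofColex b' j = f j := fun j => rfl
    refine ⟨b', lt_iff.2 ⟨i, fun j hj => ?_, ?_⟩, le_of_coeff_le fun j => ?_⟩
    · rw [hb']; simp [f, hj]
    · rw [hb']; simp [f]; omega
    · rw [add_coeff, hb']
      simp only [f]
      split_ifs with h3 h4
      · exact (h1 j h3).le
      · subst h4; rw [add_coeff] at h2; omega
      · omega
  obtain ⟨i, h1, h2⟩ := lt_iff.1 h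
  have h3 := h2
  rw [add_coeff] at h3
  by_cases hb : 0 < ofColex b i
  · exact .inl (key b c i h1 h2 hb)
  · right
    rw [add_comm] at h1 h2
    obtain ⟨c', h, h'⟩ := key c b i h1 h2 (by omega)
    exact ⟨c', h, by rwa [add_comm]⟩

theorem exists_bound (f : ℝ → Deg) : ∃ B : Deg, ∀ r, f r < B := by
  let S : Set Ordinal.{0} := ⋃ r, ((ofColex (f r)).support : Set Ordinal.{0})
  obtain ⟨o, ho⟩ : BddAbove S := Ordinal.bddAbove_of_small
  refine ⟨toColex (Finsupp.single (Order.succ o) 1),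
    fun r => lt_iff.2 ⟨Order.succ o, fun j hj => ?_, ?_⟩⟩
  · have : ofColex (f r) j = 0 := by
      by_contra hne
      exact absurd (ho (Set.mem_iUnion.2 ⟨r, Finset.mem_coe.2 (Finsupp.mem_support_iff.2 hne)⟩))
        (not_le.2 ((Order.lt_succ o).trans hj))
    rw [this]; exact (Finsupp.single_eq_of_ne hj.ne').symm
  · have : ofColex (f r) (Order.succ o) = 0 := by
      by_contra hne
      exact absurd (ho (Set.mem_iUnion.2 ⟨r, Finset.mem_coe.2 (Finsupp.mem_support_iff.2 hne)⟩))
        (not_le.2 (Order.lt_succ o))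
    rw [this]; simp

theorem exists_add_lt {a b : Deg} (ha : 0 < a) (hb : 0 < b) :
    ∃ N < a + b, ∀ a' < a, ∀ b' < b, a' + b' < N := by
  have hne : ∀ {a : Deg}, 0 < a → ∃ q, ofColex a q ≠ 0 ∧ ∀ j, ofColex a j ≠ 0 → q ≤ j := by
    intro a ha
    have : ∃ q, ofColex a q ≠ 0 := by
      by_contra! h
      exact ha.ne' (le_antisymm (le_of_coeff_le fun j => (h j).le) (nonneg a))
    exact ⟨_, WellFounded.min_mem wellFounded_lt {q | ofColex a q ≠ 0} this,
      fun j hj => WellFounded.min_le wellFounded_lt (s := {q | ofColex a q ≠ 0}) hj⟩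
  have key : ∀ (a b : Deg) (p q : Ordinal.{0}), ofColex a p ≠ 0 → (∀ j, ofColex a j ≠ 0 → p ≤ j) →
      (∀ j, ofColex b j ≠ 0 → q ≤ j) → p ≤ q →
      ∃ N < a + b, ∀ a' < a, ∀ b' < b, a' + b' < N := by
    intro a b p q hp hpm hqm hpq
    let a0 : Deg := toColex (ofColex a - Finsupp.single p 1)
    have ha0 : ∀ j, ofColex a0 j = ofColex a j - if j = p then 1 else 0 := by
      intro j
      change (ofColex a) j - Finsupp.single p 1 j = _
      rw [Finsupp.single_apply]; simp [eq_comm]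
    have hlt : a0 < a := lt_iff.2 ⟨p, fun j hj => by rw [ha0, if_neg hj.ne']; rfl, by
      rw [ha0, if_pos rfl]; omega⟩
    refine ⟨a0 + b, add_lt_add_left hlt b, fun a' ha' b' hb' => ?_⟩
    obtain ⟨i, hi1, hi2⟩ := lt_iff.1 hb'
    have hqi : p ≤ i := hpq.trans (hqm i (by omega))
    obtain ⟨τ, hτ, haτ⟩ : ∃ τ : Deg, (∀ j, p ≤ j → ofColex τ j = 0) ∧ a' ≤ a0 + τ := by
      obtain ⟨k, hk1, hk2⟩ := lt_iff.1 ha'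
      rcases (hpm k (by omega)).eq_or_lt with rfl | hpk
      · refine ⟨toColex ((ofColex a').filter (· < p)), fun j hj => ?_, le_of_coeff_le fun j => ?_⟩
        · exact Finsupp.filter_apply_neg _ _ (not_lt.2 hj)
        · rw [add_coeff, ha0]
          rcases lt_trichotomy j p with h | h | h
          · have : ofColex (toColex ((ofColex a').filter (· < p)) : Deg) j = ofColex a' j :=
              Finsupp.filter_apply_pos _ _ h
            omega
          · subst h; simp; omega
          · have := hk1 j h; rw [if_neg h.ne']; omega
      · refine ⟨0, fun _ _ => rfl, ?_⟩
        rw [add_zero]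
        refine (lt_iff.2 ⟨k, fun j hj => ?_, ?_⟩).le
        · rw [ha0, if_neg (hpk.trans hj).ne']; exact hk1 j hj
        · rw [ha0, if_neg hpk.ne']; exact hk2
    have : τ + b' < b := lt_iff.2 ⟨i, fun j hj => by
        rw [add_coeff, hτ j (hqi.trans hj.le), hi1 j hj, zero_add], by
        rwa [add_coeff, hτ i hqi, zero_add]⟩
    calc a' + b' ≤ a0 + τ + b' := by gcongr
      _ = a0 + (τ + b') := add_assoc _ _ _
      _ < a0 + b := add_lt_add_right this a0
  obtain ⟨p, hp, hpm⟩ := hne ha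
  obtain ⟨q, hq, hqm⟩ := hne hb
  rcases le_total p q with h | h
  · exact key a b p q hp hpm hqm h
  · obtain ⟨N, h1, h2⟩ := key b a q p hq hqm hpm h
    exact ⟨N, by rwa [add_comm], fun a' ha' b' hb' => by rw [add_comm]; exact h2 b' hb' a' ha'⟩

/-- Zero or a limit. -/
def IsLim (a : Deg) : Prop := ofColex a 0 = 0

theorem nsmul_one_coeff (n : ℕ) (j : Ordinal.{0}) :
    ofColex (n • (1 : Deg)) j = if j = 0 then n else 0 := by
  change n • ofColex (1 : Deg) j = _
  rw [one_coeff]; split_ifs <;> simp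

theorem exists_isLim_add (a : Deg) : ∃ l : Deg, IsLim l ∧ ∃ m : ℕ, a = l + m • 1 := by
  refine ⟨toColex ((ofColex a).erase 0), Finsupp.erase_same, ofColex a 0, ?_⟩
  apply ofColex.injective
  ext j
  rw [add_coeff, nsmul_one_coeff]
  change _ = (ofColex a).erase 0 j + _
  rcases eq_or_ne j 0 with rfl | h
  · simp
  · simp [Finsupp.erase_ne h, h]

theorem IsLim.add {a b : Deg} (ha : IsLim a) (hb : IsLim b) : IsLim (a + b) := by
  rw [IsLim, add_coeff, ha, hb]

theorem IsLim.zero : IsLim 0 := rfl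

theorem IsLim.add_nsmul_lt {a b : Deg} (hb : IsLim b) (h : a < b) (n : ℕ) : a + n • 1 < b := by
  obtain ⟨i, h1, h2⟩ := lt_iff.1 h
  have hi : i ≠ 0 := by rintro rfl; rw [hb] at h2; omega
  refine lt_iff.2 ⟨i, fun j hj => ?_, ?_⟩
  · rw [add_coeff, nsmul_one_coeff, if_neg (zero_le.trans_lt hj).ne', add_zero, h1 j hj]
  · rwa [add_coeff, nsmul_one_coeff, if_neg hi, add_zero]

end Deg

/-- The ambient field of Hahn series with real exponents. -/
abbrev HF := HahnSeries ℝ ℝ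

namespace HF

/-- Restriction of a series to the exponents in a set. -/
noncomputable def restr (s : Set ℝ) : HF →ₗ[ℝ] HF where
  toFun y := ⟨s.indicator y.coeff, y.isPWO_support.mono fun q hq => by
    simp only [Function.mem_support, Set.indicator_apply_ne_zero, Set.mem_inter_iff] at hq
    exact hq.2⟩
  map_add' y z := by ext q; simp [Set.indicator_apply]; split_ifs <;> simp
  map_smul' r y := by ext q; simp [Set.indicator_apply]

theorem restr_coeff (s : Set ℝ) (y : HF) (q : ℝ) :
    (restr s y).coeff q = if q ∈ s then y.coeff q else 0 := by
  simp [restr, Set.indicator_apply]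

/-- The series is supported in `s`. -/
def SI (s : Set ℝ) (y : HF) : Prop := ∀ q, q ∉ s → y.coeff q = 0

theorem SI_restr (s : Set ℝ) (y : HF) : SI s (restr s y) := fun q hq => by
  rw [restr_coeff, if_neg hq]

theorem SI.mono {s u : Set ℝ} {y : HF} (h : SI s y) (hsu : s ⊆ u) : SI u y :=
  fun q hq => h q fun h' => hq (hsu h')

theorem SI.restr {s u : Set ℝ} {y : HF} (h : SI s y) : SI (u ∩ s) (restr u y) := fun q hq => by
  rw [restr_coeff]; split_ifs with h1
  · exact h q fun h2 => hq ⟨h1, h2⟩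
  · rfl

theorem SI.add {s : Set ℝ} {y z : HF} (hy : SI s y) (hz : SI s z) : SI s (y + z) := fun q hq => by
  rw [HahnSeries.coeff_add, hy q hq, hz q hq, add_zero]

theorem SI.restr_eq {s u : Set ℝ} {y : HF} (h : SI s y) (hsu : s ⊆ u) : HF.restr u y = y := by
  ext q; rw [restr_coeff]; split_ifs with h1
  · rfl
  · exact (h q fun h2 => h1 (hsu h2)).symm

theorem SI.restr_eq_zero {s u : Set ℝ} {y : HF} (h : SI s y) (hsu : ∀ q ∈ s, q ∉ u) :
    HF.restr u y = 0 := by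
  ext q; rw [restr_coeff]; split_ifs with h1
  · exact h q fun h2 => hsu q h2 h1
  · rfl

theorem SI.mul {s u v : Set ℝ} {y z : HF} (hy : SI s y) (hz : SI u z)
    (h : ∀ p ∈ s, ∀ q ∈ u, p + q ∈ v) : SI v (y * z) := fun r hr => by
  by_contra hne
  obtain ⟨p, hp, q, hq, rfl⟩ := HahnSeries.support_mul_subset hne
  refine hr (h p ?_ q ?_)
  · by_contra h'; exact hp (hy p h')
  · by_contra h'; exact hq (hz q h')

theorem restr_restr (s u : Set ℝ) (y : HF) : restr s (restr u y) = restr (s ∩ u) y := by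
  ext q; simp only [restr_coeff, Set.mem_inter_iff]; split_ifs <;> simp_all

theorem restr_add_restr (s u v : Set ℝ) (y : HF) (h : s ∪ u = v) (hd : ∀ q ∈ s, q ∉ u) :
    restr s y + restr u y = restr v y := by
  subst h
  ext q; simp only [HahnSeries.coeff_add, restr_coeff, Set.mem_union]
  by_cases h1 : q ∈ s
  · simp [h1, hd q h1]
  · simp [h1]

/-- The monomial with exponent `δ`. -/
noncomputable def t (δ : ℝ) : HF := HahnSeries.single δ 1

theorem t_mul_coeff (δ : ℝ) (y : HF) (q : ℝ) : (t δ * y).coeff q = y.coeff (q - δ) := by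
  have := HahnSeries.coeff_single_mul_add (r := (1 : ℝ)) (x := y) (a := q - δ) (b := δ)
  rw [sub_add_cancel, one_mul] at this
  exact this

theorem t_mul_t (δ ε : ℝ) : t δ * t ε = t (δ + ε) := by simp [t]

theorem t_zero : t 0 = 1 := rfl

theorem t_mul_t_mul (δ ε : ℝ) (y : HF) : t δ * (t ε * y) = t (δ + ε) * y := by
  rw [← mul_assoc, t_mul_t]

theorem restr_t_mul (s : Set ℝ) (δ : ℝ) (y : HF) :
    restr s (t δ * y) = t δ * restr ((· + δ) ⁻¹' s) y := by
  ext q; simp [restr_coeff, t_mul_coeff]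

theorem SI_t_mul {s u : Set ℝ} {y : HF} (δ : ℝ) (h : SI s y) (hu : ∀ q ∈ s, δ + q ∈ u) :
    SI u (t δ * y) := fun q hq => by
  rw [t_mul_coeff]; refine h _ fun h' => hq ?_
  simpa using hu _ h'

/-- Series with nonpositive support. -/
noncomputable def N0 : Submodule ℝ HF where
  carrier := {y | SI (Set.Iic 0) y}
  add_mem' := SI.add
  zero_mem' := fun _ _ => rfl
  smul_mem' r y hy := fun q hq => by simp [hy q hq]

theorem N0_mul {y z : HF} (hy : y ∈ N0) (hz : z ∈ N0) : y * z ∈ N0 :=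
  SI.mul hy hz fun p hp q hq => by simp at *; linarith

theorem one_mem_N0 : (1 : HF) ∈ N0 := fun q hq => by
  rw [← t_zero, t, HahnSeries.coeff_single_of_ne]; rintro rfl; simp at hq

theorem restr_mem_N0 {y : HF} (s : Set ℝ) (hy : y ∈ N0) : restr s y ∈ N0 :=
  (SI.restr hy).mono Set.inter_subset_right

/-- Truncation at `γ`. -/
noncomputable abbrev tr (γ : ℝ) : HF →ₗ[ℝ] HF := restr (Set.Iic γ)

/-- Series in `N0` all of whose proper truncations have degree below `α`. -/
noncomputable def P (α : Deg) : Submodule ℝ HF :=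
  N0 ⊓ ⨅ γ : Set.Iio (0 : ℝ), (Submodule.span ℝ
    {y | ∃ β, ∃ _ : β < α, ∃ δ : ℝ, ∃ c ∈ P β, y = t δ * c}).comap (tr γ)
termination_by wellFounded_lt.wrap α

/-- The span of the translates of the series in `P β` for `β < α`. -/
noncomputable def G (α : Deg) : Submodule ℝ HF :=
  Submodule.span ℝ {y | ∃ β < α, ∃ δ : ℝ, ∃ c ∈ P β, y = t δ * c}

theorem mem_P {α : Deg} {b : HF} : b ∈ P α ↔ b ∈ N0 ∧ ∀ γ < 0, tr γ b ∈ G α := by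
  rw [P, Submodule.mem_inf, Submodule.mem_iInf]
  simp only [Submodule.mem_comap, Subtype.forall, Set.mem_Iio, exists_prop, G]

theorem t_mul_mem_G_of_P {α β : Deg} (h : β < α) (δ : ℝ) {c : HF} (hc : c ∈ P β) : t δ * c ∈ G α :=
  Submodule.subset_span ⟨β, h, δ, c, hc, rfl⟩

theorem P_le_G {α β : Deg} (h : β < α) : P β ≤ G α := fun c hc => by
  simpa [t_zero] using t_mul_mem_G_of_P h 0 hc

theorem G_induction {α : Deg} {K : Submodule ℝ HF}
    (h : ∀ β < α, ∀ δ : ℝ, ∀ c ∈ P β, t δ * c ∈ K) : G α ≤ K := by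
  rw [G, Submodule.span_le]
  rintro _ ⟨β, hβ, δ, c, hc, rfl⟩
  exact h β hβ δ c hc

theorem G_mono {α β : Deg} (h : α ≤ β) : G α ≤ G β :=
  G_induction fun _ hβ δ _ hc => t_mul_mem_G_of_P (hβ.trans_le h) δ hc

theorem P_mono {α β : Deg} (h : α ≤ β) : P α ≤ P β := fun _ hb => by
  rw [mem_P] at hb ⊢
  exact ⟨hb.1, fun γ hγ => G_mono h (hb.2 γ hγ)⟩

/-- Multiplication by a fixed series, as a linear map. -/
noncomputable def mulL (z : HF) : HF →ₗ[ℝ] HF where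
  toFun y := z * y
  map_add' := mul_add z
  map_smul' r y := by
    rw [← HahnSeries.single_zero_mul_eq_smul, mul_left_comm, HahnSeries.single_zero_mul_eq_smul]
    rfl

theorem mulL_apply (z y : HF) : mulL z y = z * y := rfl

theorem t_mul_mem_G {α : Deg} (δ : ℝ) {y : HF} (hy : y ∈ G α) : t δ * y ∈ G α := by
  have : G α ≤ (G α).comap (mulL (t δ)) := G_induction fun β hβ ε c hc => by
    rw [Submodule.mem_comap, mulL_apply, t_mul_t_mul]
    exact t_mul_mem_G_of_P hβ _ hc
  exact this hy

theorem tr_mem_G {α : Deg} (γ : ℝ) {y : HF} (hy : y ∈ G α) : tr γ y ∈ G α := by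
  have : G α ≤ (G α).comap (tr γ) := G_induction fun β hβ ε c hc => by
    have h1 := mem_P.1 hc
    rw [Submodule.mem_comap, restr_t_mul]
    apply t_mul_mem_G
    have : ((· + ε) ⁻¹' Set.Iic γ) = Set.Iic (γ - ε) := by ext; simp [le_sub_iff_add_le]
    rw [this]
    rcases lt_or_ge (γ - ε) 0 with h | h
    · exact G_mono hβ.le (h1.2 _ h)
    · rw [SI.restr_eq h1.1 (Set.Iic_subset_Iic.2 h)]; exact P_le_G hβ hc
  exact this hy

theorem restr_Ioi (γ : ℝ) (y : HF) : restr (Set.Ioi γ) y = y - tr γ y := by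
  ext q; rw [HahnSeries.coeff_sub, restr_coeff, restr_coeff]
  by_cases h : γ < q
  · simp [h, not_le.2 h]
  · simp [h, not_lt.1 h]

theorem restr_Ioi_mem_G {α : Deg} (γ : ℝ) {y : HF} (hy : y ∈ G α) : restr (Set.Ioi γ) y ∈ G α := by
  rw [restr_Ioi]; exact sub_mem hy (tr_mem_G γ hy)

theorem G_zero : G 0 = ⊥ :=
  le_bot_iff.1 (G_induction fun β hβ => absurd hβ (not_lt.2 (Deg.nonneg β)))

theorem mul_mem_G {α N : Deg} {y z : HF} (hy : y ∈ G α)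
    (h : ∀ α' < α, ∀ c ∈ P α', c * z ∈ G N) : y * z ∈ G N := by
  have : G α ≤ (G N).comap (mulL z) := G_induction fun β hβ ε c hc => by
    rw [Submodule.mem_comap, mulL_apply, mul_comm, mul_assoc]
    exact t_mul_mem_G _ (h β hβ c hc)
  have := this hy
  rwa [Submodule.mem_comap, mulL_apply, mul_comm] at this

theorem tr_eq_zero_of_SI {γ : ℝ} {y : HF} (h : SI (Set.Ioi γ) y) : tr γ y = 0 :=
  h.restr_eq_zero fun _ hq => by simpa using hq

theorem P_mul {α β : Deg} {b c : HF} (hb : b ∈ P α) (hc : c ∈ P β) : b * c ∈ P (α + β) := by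
  induction hσ : α + β using WellFoundedLT.induction generalizing α β b c with
  | ind σ ih =>
  subst hσ
  refine mem_P.2 ⟨N0_mul (mem_P.1 hb).1 (mem_P.1 hc).1, fun γ hγ => ?_⟩
  have hb1 := (mem_P.1 hb).2 (γ / 2) (by linarith)
  have hc1 := (mem_P.1 hc).2 (γ / 2) (by linarith)
  set b1 := tr (γ / 2) b
  set c1 := tr (γ / 2) c
  have e : b * c = (b1 * c + b * c1 - b1 * c1) + (b - b1) * (c - c1) := by ring
  have e2 : tr γ ((b - b1) * (c - c1)) = 0 := by
    rw [← restr_Ioi, ← restr_Ioi]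
    refine tr_eq_zero_of_SI (SI.mul (SI_restr _ _) (SI_restr _ _) fun p hp q hq => ?_)
    simp only [Set.mem_Ioi] at *; linarith
  rw [e, map_add, e2, add_zero]
  apply tr_mem_G
  refine sub_mem (add_mem ?_ ?_) ?_
  · exact mul_mem_G hb1 fun α' hα' d hd => by
      have : α' + β < α + β := add_lt_add_left hα' β
      exact P_le_G this (ih _ this hd hc rfl)
  · rw [mul_comm]
    exact mul_mem_G hc1 fun β' hβ' d hd => by
      have : α + β' < α + β := add_lt_add_right hβ' α
      rw [mul_comm]
      exact P_le_G this (ih _ this hb hd rfl)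
  · exact mul_mem_G hb1 fun α' hα' d hd => by
      rw [mul_comm]
      exact mul_mem_G hc1 fun β' hβ' e he => by
        have : α' + β' < α + β := add_lt_add hα' hβ'
        rw [mul_comm]
        exact P_le_G this (ih _ this hd he rfl)

theorem exists_gap (y : HF) (σ : ℝ) :
    ∃ κ > 0, SI (Set.Ioc σ (σ + κ))ᶜ y := by
  by_cases h : (y.support ∩ Set.Ioi σ).Nonempty
  · have hwf : (y.support ∩ Set.Ioi σ).IsWF := y.isWF_support.mono Set.inter_subset_left
    have h1 := hwf.min_mem h
    refine ⟨(hwf.min h - σ) / 2, by have := h1.2; simp only [Set.mem_Ioi] at this; linarith,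
      fun q hq => ?_⟩
    simp only [Set.mem_compl_iff, Set.mem_Ioc, not_not] at hq
    by_contra hne
    have := hwf.min_le h ⟨hne, hq.1⟩
    have := h1.2; simp only [Set.mem_Ioi] at this
    linarith [hq.2]
  · refine ⟨1, one_pos, fun q hq => ?_⟩
    simp only [Set.mem_compl_iff, Set.mem_Ioc, not_not] at hq
    by_contra hne
    exact h ⟨q, hne, hq.1⟩

theorem tr_tr (γ δ : ℝ) (y : HF) : tr γ (tr δ y) = tr (min γ δ) y := by
  rw [restr_restr]; congr 1; ext; simp

theorem tr_induction {K : Submodule ℝ HF} {y : HF} {B : ℝ} (hB : SI (Set.Iic B) y)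
    (h : ∀ δ, (∀ γ < δ, tr γ y ∈ K) → tr δ y ∈ K) : y ∈ K := by
  have hyB : tr B y = y := hB.restr_eq le_rfl
  by_contra hy
  set S : Set ℝ := {δ | tr δ y ∉ K}
  have hS : S.Nonempty := ⟨B, by simpa only [S, Set.mem_ofPred_eq, hyB] using hy⟩
  have hbdd : BddBelow S := by
    refine ⟨y.order, fun δ hδ => ?_⟩
    by_contra! hlt
    apply hδ
    have : tr δ y = 0 := by
      ext q; rw [restr_coeff]; split_ifs with h1
      · exact HahnSeries.coeff_eq_zero_of_lt_order (lt_of_le_of_lt h1 hlt)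
      · rfl
    rw [this]; exact zero_mem K
  have hσ : tr (sInf S) y ∈ K := h _ fun γ hγ => by
    by_contra h'; exact absurd (csInf_le hbdd h') (not_le.2 hγ)
  obtain ⟨κ, hκ, hgap⟩ := exists_gap y (sInf S)
  obtain ⟨δ, hδ, hlt⟩ := exists_lt_of_csInf_lt hS (lt_add_of_pos_right (sInf S) hκ)
  apply hδ
  have : tr δ y = tr (sInf S) y := by
    ext q; simp only [restr_coeff, Set.mem_Iic]
    by_cases h1 : q ≤ sInf S
    · rw [if_pos h1, if_pos (h1.trans (csInf_le hbdd hδ))]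
    · rw [if_neg h1]; split_ifs with h2
      · exact hgap q (by simp; exact ⟨not_le.1 h1, h2.trans hlt.le⟩)
      · rfl
  rwa [this]

/-- The germ of `b` at `δ`, translated to `0`. -/
noncomputable def dd (δ : ℝ) : HF →ₗ[ℝ] HF := mulL (t (-δ)) ∘ₗ tr δ

theorem dd_apply (δ : ℝ) (y : HF) : dd δ y = t (-δ) * tr δ y := rfl

theorem tr_eq_t_mul_dd (δ : ℝ) (y : HF) : tr δ y = t δ * dd δ y := by
  rw [dd_apply, t_mul_t_mul, add_neg_cancel, t_zero, one_mul]

theorem dd_mem_N0 (δ : ℝ) (y : HF) : dd δ y ∈ N0 :=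
  SI_t_mul _ (SI_restr _ _) fun q hq => by simpa using hq

theorem restr_Ioi_dd (η δ : ℝ) (y : HF) :
    restr (Set.Ioi η) (dd δ y) = t (-δ) * restr (Set.Ioc (δ + η) δ) y := by
  rw [dd_apply, restr_t_mul, restr_restr]
  congr 3; ext; simp; intro; constructor <;> intro <;> linarith

/-- Germs at `0` of degree below `α`. -/
noncomputable def I (α : Deg) : Submodule ℝ HF where
  carrier := {b | b ∈ N0 ∧ ∃ η > 0, restr (Set.Ioi (-η)) b ∈ G α}
  add_mem' := by
    rintro a b ⟨ha, η, hη, h1⟩ ⟨hb, θ, hθ, h2⟩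
    refine ⟨add_mem ha hb, min η θ, lt_min hη hθ, ?_⟩
    rw [map_add]
    have e : ∀ (u : ℝ) (y : HF), min η θ ≤ u → restr (Set.Ioi (-u)) y ∈ G α →
        restr (Set.Ioi (-(min η θ))) y ∈ G α := fun u y hu h => by
      have := restr_Ioi_mem_G (-(min η θ)) h
      rwa [restr_restr, Set.inter_eq_left.2 (Set.Ioi_subset_Ioi (neg_le_neg hu))] at this
    exact add_mem (e η a (min_le_left _ _) h1) (e θ b (min_le_right _ _) h2)
  zero_mem' := ⟨zero_mem _, 1, one_pos, by rw [map_zero]; exact zero_mem _⟩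
  smul_mem' := by
    rintro r a ⟨ha, η, hη, h1⟩
    exact ⟨N0.smul_mem r ha, η, hη, by rw [map_smul]; exact (G α).smul_mem r h1⟩

theorem I_mono {α β : Deg} (h : α ≤ β) : I α ≤ I β := by
  rintro b ⟨h0, η, hη, h1⟩
  exact ⟨h0, η, hη, G_mono h h1⟩

theorem mem_I_of_mem_G {α : Deg} {b : HF} (h0 : b ∈ N0) (h : b ∈ G α) : b ∈ I α :=
  ⟨h0, 1, one_pos, restr_Ioi_mem_G _ h⟩

theorem mem_I_of_SI {b : HF} {η : ℝ} (hη : η < 0) (h : SI (Set.Iic η) b) (α : Deg) : b ∈ I α := by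
  refine ⟨h.mono (Set.Iic_subset_Iic.2 hη.le), -η, by linarith, ?_⟩
  rw [neg_neg, h.restr_eq_zero fun q hq => by simpa using hq]; exact zero_mem _

theorem exists_SI_of_mem_I_zero {b : HF} (h : b ∈ I 0) : ∃ η < 0, SI (Set.Iic η) b := by
  obtain ⟨h0, η, hη, h1⟩ := h
  rw [G_zero, Submodule.mem_bot] at h1
  refine ⟨-η, by linarith, fun q hq => ?_⟩
  have := congrArg (fun y => y.coeff q) h1
  simp only [restr_coeff] at this
  rwa [if_pos (by simpa using hq)] at this

theorem mem_G_of_forall_dd {α : Deg} {y : HF} {B : ℝ} (hB : SI (Set.Iic B) y)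
    (h : ∀ δ, dd δ y ∈ I α) : y ∈ G α := by
  refine tr_induction hB fun δ hδ => ?_
  obtain ⟨_, η, hη, h1⟩ := h δ
  rw [restr_Ioi_dd] at h1
  have := t_mul_mem_G δ h1
  rw [t_mul_t_mul, add_neg_cancel, t_zero, one_mul] at this
  rw [← restr_add_restr (Set.Iic (δ + -η)) (Set.Ioc (δ + -η) δ) _ y
    (Set.Iic_union_Ioc_eq_Iic (by linarith)) (fun q hq => by simp at *; intro; linarith)]
  exact add_mem (hδ _ (by linarith)) this

theorem exists_mem_G {y : HF} {B : ℝ} (hB : SI (Set.Iic B) y) : ∃ α, y ∈ G α := by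
  let K : Submodule ℝ HF :=
    { carrier := {y | ∃ α, y ∈ G α}
      add_mem' := by
        rintro a b ⟨α, ha⟩ ⟨β, hb⟩
        exact ⟨max α β, add_mem (G_mono (le_max_left _ _) ha) (G_mono (le_max_right _ _) hb)⟩
      zero_mem' := ⟨0, zero_mem _⟩
      smul_mem' := by
        rintro r a ⟨α, ha⟩
        exact ⟨α, (G α).smul_mem r ha⟩ }
  refine tr_induction (K := K) hB fun δ hδ => ?_
  obtain ⟨C, hC⟩ := Deg.exists_bound fun γ => if h : γ < δ then (hδ γ h).choose else 0
  have h1 : ∀ γ < δ, tr γ y ∈ G C := fun γ hγ => by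
    have := hC γ
    rw [dif_pos hγ] at this
    exact G_mono this.le (hδ γ hγ).choose_spec
  have h2 : dd δ y ∈ P C := by
    refine mem_P.2 ⟨dd_mem_N0 _ _, fun γ hγ => ?_⟩
    rw [dd_apply, restr_t_mul, restr_restr]
    apply t_mul_mem_G
    convert h1 (γ + δ) (by linarith) using 3
    ext; simp; intro; linarith
  exact ⟨C + 1, by rw [tr_eq_t_mul_dd]; exact t_mul_mem_G_of_P (Deg.lt_add_one C) _ h2⟩

end HF

namespace HF
open Filter Topology

theorem dd_mem_I_of_SI {η δ : ℝ} {b : HF} (h : SI (Set.Iic η) b) (hδ : η < δ) (α : Deg) :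
    dd δ b ∈ I α := by
  refine mem_I_of_SI (η := η - δ) (by linarith) ?_ α
  rw [dd_apply]
  refine SI_t_mul _ h.restr fun q hq => ?_
  have := hq.2
  simp only [Set.mem_Iic] at *; linarith

theorem eventually_Ioo {η : ℝ} (h : η < 0) : ∀ᶠ δ in 𝓝[<] (0 : ℝ), η < δ ∧ δ < 0 :=
  Ioo_mem_nhdsLT h

theorem exists_of_eventually {p : ℝ → Prop} (h : ∀ᶠ δ in 𝓝[<] (0 : ℝ), p δ) :
    ∃ η > 0, ∀ δ, -η < δ → δ < 0 → p δ := by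
  obtain ⟨l, hl, hs⟩ := mem_nhdsLT_iff_exists_Ioo_subset.1 h
  exact ⟨-l, by simpa using hl, fun δ h1 h2 => hs ⟨by simpa using h1, h2⟩⟩

theorem eventually_dd_of_mem_G {α : Deg} (hα : 0 < α) {y : HF} (hy : y ∈ G α) :
    ∃ α' < α, ∀ᶠ δ in 𝓝[<] (0 : ℝ), dd δ y ∈ I α' := by
  let K : Submodule ℝ HF :=
    { carrier := {y | ∃ α' < α, ∀ᶠ δ in 𝓝[<] (0 : ℝ), dd δ y ∈ I α'}
      add_mem' := by
        rintro a b ⟨β, hβ, ha⟩ ⟨γ, hγ, hb⟩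
        refine ⟨max β γ, max_lt hβ hγ, ?_⟩
        filter_upwards [ha, hb] with δ h1 h2
        rw [map_add]
        exact add_mem (I_mono (le_max_left _ _) h1) (I_mono (le_max_right _ _) h2)
      zero_mem' := ⟨0, hα, Eventually.of_forall fun δ => by rw [map_zero]; exact zero_mem _⟩
      smul_mem' := by
        rintro r a ⟨β, hβ, ha⟩
        refine ⟨β, hβ, ?_⟩
        filter_upwards [ha] with δ h1
        rw [map_smul]; exact (I β).smul_mem r h1 }
  have : G α ≤ K := G_induction fun β hβ ε c hc => by
    refine ⟨β, hβ, ?_⟩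
    have h1 := mem_P.1 hc
    rcases lt_or_ge ε 0 with h | h
    · filter_upwards [eventually_Ioo h] with δ hδ
      refine dd_mem_I_of_SI (η := ε) (SI_t_mul _ h1.1 fun q hq => ?_) hδ.1 β
      simp only [Set.mem_Iic] at *; linarith
    · filter_upwards [self_mem_nhdsWithin] with δ hδ
      refine mem_I_of_mem_G (dd_mem_N0 _ _) ?_
      rw [dd_apply, restr_t_mul]
      refine t_mul_mem_G _ (t_mul_mem_G _ ?_)
      have e : ((· + ε) ⁻¹' Set.Iic δ) = Set.Iic (δ - ε) := by ext; simp [le_sub_iff_add_le]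
      rw [e]
      simp only [Set.mem_Iio] at hδ
      exact h1.2 _ (by linarith)
  exact this hy

theorem dd_sub_dd_restr_mem {η δ : ℝ} (hδ : -η < δ) (b : HF) (α : Deg) :
    dd δ b - dd δ (restr (Set.Ioi (-η)) b) ∈ I α := by
  rw [← map_sub, restr_Ioi, sub_sub_cancel]
  exact dd_mem_I_of_SI (SI_restr _ _) hδ α

theorem eventually_dd_of_mem_I {α : Deg} (hα : 0 < α) {b : HF} (hb : b ∈ I α) :
    ∃ α' < α, ∀ᶠ δ in 𝓝[<] (0 : ℝ), dd δ b ∈ I α' := by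
  obtain ⟨h0, η, hη, h1⟩ := hb
  obtain ⟨α', hα', h2⟩ := eventually_dd_of_mem_G hα h1
  refine ⟨α', hα', ?_⟩
  filter_upwards [h2, eventually_Ioo (neg_lt_zero.2 hη)] with δ h3 h4
  have := add_mem (dd_sub_dd_restr_mem h4.1 b α') h3
  rwa [sub_add_cancel] at this

theorem exists_mem_P_of_eventually {α : Deg} {b : HF} (h0 : b ∈ N0)
    (h : ∀ᶠ δ in 𝓝[<] (0 : ℝ), dd δ b ∈ I α) : ∃ η > 0, restr (Set.Ioi (-η)) b ∈ P α := by
  obtain ⟨η, hη, hs⟩ := exists_of_eventually h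
  refine ⟨η, hη, mem_P.2 ⟨restr_mem_N0 _ h0, fun γ hγ => ?_⟩⟩
  refine mem_G_of_forall_dd (B := γ) (SI_restr _ _) fun δ => ?_
  rcases lt_or_ge γ δ with h1 | h1
  · exact dd_mem_I_of_SI (SI_restr _ _) h1 α
  · rw [dd_apply, tr_tr, min_eq_left h1, ← dd_apply]
    rcases lt_or_ge (-η) δ with h2 | h2
    · have := sub_mem (hs δ h2 (h1.trans_lt hγ)) (dd_sub_dd_restr_mem h2 b α)
      rwa [sub_sub_cancel] at this
    · rw [dd_apply, restr_restr]
      have : Set.Iic δ ∩ Set.Ioi (-η) = ∅ := by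
        ext q; simp; intro h; linarith
      rw [this, SI.restr_eq_zero (s := Set.univ) (fun q hq => absurd trivial hq) (by simp),
        mul_zero]
      exact zero_mem _

theorem exists_mem_P_of_mem_I {α : Deg} (hα : 0 < α) {b : HF} (hb : b ∈ I α) :
    ∃ α' < α, ∃ η > 0, restr (Set.Ioi (-η)) b ∈ P α' := by
  obtain ⟨α', hα', h⟩ := eventually_dd_of_mem_I hα hb
  exact ⟨α', hα', exists_mem_P_of_eventually hb.1 h⟩

theorem mem_I_of_restr_mem_P {α β : Deg} (hβ : β < α) {b : HF} {η : ℝ} (h0 : b ∈ N0) (hη : 0 < η)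
    (h : restr (Set.Ioi (-η)) b ∈ P β) : b ∈ I α :=
  ⟨h0, η, hη, P_le_G hβ h⟩

theorem mem_I_of_eventually {α β : Deg} (hβ : β < α) {b : HF} (h0 : b ∈ N0)
    (h : ∀ᶠ δ in 𝓝[<] (0 : ℝ), dd δ b ∈ I β) : b ∈ I α := by
  obtain ⟨η, hη, h1⟩ := exists_mem_P_of_eventually h0 h
  exact mem_I_of_restr_mem_P hβ h0 hη h1

/-- Germs at `0` of degree at most `α`. -/
noncomputable abbrev V (α : Deg) : Submodule ℝ HF := I (α + 1)

theorem I_le_V (α : Deg) : I α ≤ V α := I_mono (Deg.lt_add_one α).le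

theorem V_le_I {α β : Deg} (h : α < β) : V α ≤ I β := I_mono (Deg.add_one_le_iff.2 h)

theorem mem_V_iff {α : Deg} {b : HF} :
    b ∈ V α ↔ b ∈ N0 ∧ ∃ η > 0, restr (Set.Ioi (-η)) b ∈ P α := by
  constructor
  · intro h
    obtain ⟨α', h1, η, hη, h2⟩ :=
      exists_mem_P_of_mem_I ((Deg.nonneg α).trans_lt (Deg.lt_add_one α)) h
    exact ⟨h.1, η, hη, P_mono (Deg.lt_add_one_iff.1 h1) h2⟩
  · rintro ⟨h0, η, hη, h⟩
    exact mem_I_of_restr_mem_P (Deg.lt_add_one α) h0 hη h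

theorem P_le_V (α : Deg) : P α ≤ V α := fun _ hb =>
  mem_I_of_mem_G (mem_P.1 hb).1 (P_le_G (Deg.lt_add_one α) hb)

theorem restr_Ioi_mem_P {α : Deg} (γ : ℝ) {b : HF} (h : b ∈ P α) : restr (Set.Ioi γ) b ∈ P α := by
  rw [mem_P] at *
  refine ⟨restr_mem_N0 _ h.1, fun δ hδ => ?_⟩
  rw [restr_restr, Set.inter_comm, ← restr_restr]
  exact restr_Ioi_mem_G _ (h.2 δ hδ)

theorem exists_common_P {α β : Deg} {b c : HF} (hb : b ∈ V α) (hc : c ∈ V β) :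
    ∃ η > 0, restr (Set.Ioi (-η)) b ∈ P α ∧ restr (Set.Ioi (-η)) c ∈ P β := by
  obtain ⟨_, η, hη, h1⟩ := mem_V_iff.1 hb
  obtain ⟨_, θ, hθ, h2⟩ := mem_V_iff.1 hc
  have e : ∀ (u : ℝ) (γ : Deg) (y : HF), min η θ ≤ u → restr (Set.Ioi (-u)) y ∈ P γ →
      restr (Set.Ioi (-(min η θ))) y ∈ P γ := fun u γ y hu h => by
    have := restr_Ioi_mem_P (-(min η θ)) h
    rwa [restr_restr, Set.inter_eq_left.2 (Set.Ioi_subset_Ioi (neg_le_neg hu))] at this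
  exact ⟨min η θ, lt_min hη hθ, e _ _ _ (min_le_left _ _) h1, e _ _ _ (min_le_right _ _) h2⟩

theorem I_zero_mul {b c : HF} (hb : b ∈ I 0) (hc : c ∈ N0) : b * c ∈ I 0 := by
  obtain ⟨η, hη, h⟩ := exists_SI_of_mem_I_zero hb
  exact mem_I_of_SI hη (SI.mul h hc fun p hp q hq => by simp at *; linarith) 0

theorem V_mul {α β : Deg} {b c : HF} (hb : b ∈ V α) (hc : c ∈ V β) : b * c ∈ V (α + β) := by
  obtain ⟨η, hη, h1, h2⟩ := exists_common_P hb hc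
  have hη' : -η < 0 := by linarith
  rw [restr_Ioi] at h1 h2
  have hb0 : tr (-η) b ∈ I 0 := mem_I_of_SI hη' (SI_restr _ _) 0
  have hc0 : tr (-η) c ∈ I 0 := mem_I_of_SI hη' (SI_restr _ _) 0
  have e : b * c = (b - tr (-η) b) * (c - tr (-η) c) + tr (-η) b * (c - tr (-η) c)
      + tr (-η) c * b := by ring
  rw [e]
  refine add_mem (add_mem (P_le_V _ (P_mul h1 h2)) ?_) ?_
  · exact I_mono (Deg.nonneg _) (I_zero_mul hb0 (mem_P.1 h2).1)
  · exact I_mono (Deg.nonneg _) (I_zero_mul hc0 hb.1)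

theorem exists_mem_V_of_mem_I {α : Deg} (hα : 0 < α) {b : HF} (hb : b ∈ I α) :
    ∃ α' < α, b ∈ V α' := by
  obtain ⟨α', h1, h2⟩ := exists_mem_P_of_mem_I hα hb
  exact ⟨α', h1, mem_V_iff.2 ⟨hb.1, h2⟩⟩

theorem I_mul_V {α β : Deg} {b c : HF} (hb : b ∈ I α) (hc : c ∈ V β) : b * c ∈ I (α + β) := by
  rcases (Deg.nonneg α).eq_or_lt with rfl | hα
  · exact I_mono (Deg.nonneg _) (I_zero_mul hb hc.1)
  · obtain ⟨α', h1, h2⟩ := exists_mem_V_of_mem_I hα hb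
    exact V_le_I (add_lt_add_left h1 β) (V_mul h2 hc)

theorem V_mul_I {α β : Deg} {b c : HF} (hb : b ∈ V α) (hc : c ∈ I β) : b * c ∈ I (α + β) := by
  rw [mul_comm, add_comm]; exact I_mul_V hc hb

theorem tr_mul_eq {b c : HF} {δ κ : ℝ} (hb : SI (Set.Ioi (δ + κ)) b) (hc : SI (Set.Ioi (δ + κ)) c) :
    tr δ (b * c) = tr δ (tr (-κ) b * tr (-κ) c) := by
  have e : b * c = tr (-κ) b * tr (-κ) c + (b - tr (-κ) b) * c
      + tr (-κ) b * (c - tr (-κ) c) := by ring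
  have e1 : tr δ ((b - tr (-κ) b) * c) = 0 := by
    rw [← restr_Ioi]
    exact tr_eq_zero_of_SI (SI.mul (SI_restr _ _) hc fun p hp q hq => by
      simp at *; linarith)
  have e2 : tr δ (tr (-κ) b * (c - tr (-κ) c)) = 0 := by
    rw [← restr_Ioi]
    exact tr_eq_zero_of_SI (SI.mul (hb.restr.mono Set.inter_subset_right) (SI_restr _ _)
      fun p hp q hq => by simp at *; linarith)
  rw [e, map_add, map_add, e1, e2, add_zero, add_zero]

theorem eventually_dd_mul {a b : Deg} {y z : HF} (hy : y ∈ V a) (hz : z ∈ V b) (hab : 0 < a + b) :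
    ∃ N < a + b, ∀ᶠ δ in 𝓝[<] (0 : ℝ), dd δ (y * z) - dd δ y * z - y * dd δ z ∈ I N := by
  obtain ⟨N, hN, hN'⟩ : ∃ N < a + b, ∀ y' ∈ G a, ∀ z' ∈ G b, y' * z' ∈ G N := by
    rcases (Deg.nonneg a).eq_or_lt with rfl | ha
    · refine ⟨0, hab, fun y' hy' z' _ => ?_⟩
      rw [G_zero, Submodule.mem_bot] at hy'
      rw [hy', zero_mul]; exact zero_mem _
    rcases (Deg.nonneg b).eq_or_lt with rfl | hb
    · refine ⟨0, hab, fun y' _ z' hz' => ?_⟩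
      rw [G_zero, Submodule.mem_bot] at hz'
      rw [hz', mul_zero]; exact zero_mem _
    obtain ⟨N, hN, h⟩ := Deg.exists_add_lt ha hb
    refine ⟨N, hN, fun y' hy' z' hz' => mul_mem_G hy' fun a' ha' d hd => ?_⟩
    rw [mul_comm]
    exact mul_mem_G hz' fun b' hb' e he => by
      rw [mul_comm]; exact P_le_G (h a' ha' b' hb') (P_mul hd he)
  refine ⟨N, hN, ?_⟩
  obtain ⟨η, hη, h1, h2⟩ := exists_common_P hy hz
  filter_upwards [eventually_Ioo (neg_lt_zero.2 hη)] with δ ⟨hδ, hδ0⟩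
  obtain ⟨κ₁, hκ₁, g1⟩ := exists_gap y δ
  obtain ⟨κ₂, hκ₂, g2⟩ := exists_gap z δ
  set κ := min κ₁ κ₂
  have hκ : 0 < κ := lt_min hκ₁ hκ₂
  have hgap : ∀ (w : HF) (κ' : ℝ), κ ≤ κ' → SI (Set.Ioc δ (δ + κ'))ᶜ w →
      SI (Set.Ioi (δ + κ)) (restr (Set.Ioi δ) w) := fun w κ' hκ' hw q hq => by
    rw [restr_coeff]; split_ifs with h
    · have : q ≤ δ + κ := by simpa using hq
      exact hw q fun h' => h' ⟨h, by linarith⟩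
    · rfl
  have key : ∀ (w : HF) (c : Deg), restr (Set.Ioi (-η)) w ∈ P c →
      tr (-κ) (restr (Set.Ioi δ) w) ∈ G c := fun w c hw => by
    have := restr_Ioi_mem_G δ ((mem_P.1 hw).2 (-κ) (by linarith))
    rw [restr_restr, restr_restr] at this
    rw [restr_restr]
    convert this using 3
    ext q; simp only [Set.mem_inter_iff, Set.mem_Iic, Set.mem_Ioi]; constructor
    · rintro ⟨h, h'⟩; exact ⟨⟨h', h⟩, by linarith⟩
    · rintro ⟨⟨h, h'⟩, _⟩; exact ⟨h', h⟩
  have e : dd δ (y * z) - dd δ y * z - y * dd δ z =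
      t (-δ) * tr δ (restr (Set.Ioi δ) y * restr (Set.Ioi δ) z) - t (-δ) * (tr δ y * tr δ z) := by
    have : tr δ (y * z) = tr δ (restr (Set.Ioi δ) y * restr (Set.Ioi δ) z) +
        (tr δ y * z + y * tr δ z - tr δ y * tr δ z) := by
      have e1 : y * z = restr (Set.Ioi δ) y * restr (Set.Ioi δ) z +
        (tr δ y * z + y * tr δ z - tr δ y * tr δ z) := by rw [restr_Ioi, restr_Ioi]; ring
      have e2 : tr δ (tr δ y * z + y * tr δ z - tr δ y * tr δ z) =
          tr δ y * z + y * tr δ z - tr δ y * tr δ z := by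
        have hN : ∀ u v : HF, u ∈ N0 → SI (Set.Iic δ) v → tr δ (u * v) = u * v := fun u v hu hv =>
          SI.restr_eq (SI.mul hu hv (v := Set.Iic δ) fun p hp q hq => by simp at *; linarith) le_rfl
        rw [map_sub, map_add, mul_comm _ z, hN _ _ hz.1 (SI_restr _ _), hN _ _ hy.1 (SI_restr _ _),
          hN _ _ (restr_mem_N0 _ hy.1) (SI_restr _ _)]
      conv_lhs => rw [e1]
      rw [map_add, e2]
    rw [dd_apply, dd_apply, dd_apply, this]; ring
  rw [e]
  refine sub_mem (mem_I_of_mem_G ?_ ?_) ?_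
  · exact dd_mem_N0 _ _
  · rw [tr_mul_eq (hgap y κ₁ (min_le_left _ _) g1) (hgap z κ₂ (min_le_right _ _) g2)]
    exact t_mul_mem_G _ (tr_mem_G _ (hN' _ (key y a h1) _ (key z b h2)))
  · refine mem_I_of_SI hδ0 (SI_t_mul (s := Set.Iic (2 * δ)) _
      (SI.mul (SI_restr _ _) (SI_restr _ _) fun p hp q hq => ?_) fun q hq => ?_) _
    · simp at *; linarith
    · simp at *; linarith

/-- The germ has degree exactly `α`. -/
def E (α : Deg) (b : HF) : Prop := b ∈ V α ∧ b ∉ I α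

theorem exists_E_of_mem_I {α : Deg} {b : HF} (hb : b ∈ I α) (h0 : b ∉ I 0) : ∃ α' < α, E α' b := by
  have hne : {γ | b ∈ I γ}.Nonempty := ⟨α, hb⟩
  have h1 := WellFounded.min_mem wellFounded_lt _ hne
  set γ := WellFounded.min wellFounded_lt _ hne
  have hγ : 0 < γ := (Deg.nonneg γ).lt_of_ne fun h => h0 (h ▸ h1)
  obtain ⟨α', h2, h3⟩ := exists_mem_V_of_mem_I hγ h1
  exact ⟨α', h2.trans_le (WellFounded.min_le wellFounded_lt (s := {γ | b ∈ I γ}) hb), h3,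
    fun h => WellFounded.not_lt_min wellFounded_lt (s := {γ | b ∈ I γ}) h h2⟩

theorem E.le {α β : Deg} {b : HF} (h : E α b) (h' : b ∈ V β) : α ≤ β := by
  by_contra! hlt
  exact h.2 (V_le_I hlt h')

theorem E.unique {α β : Deg} {b : HF} (h : E α b) (h' : E β b) : α = β :=
  le_antisymm (h.le h'.1) (h'.le h.1)

end HF

theorem Deg.exists_lt_of_lt_nsmul {α B : Deg} (j : ℕ) (h : B < (j + 1) • α) :
    ∃ c < α, B ≤ j • α + c := by
  induction j generalizing B with
  | zero => exact ⟨B, by simpa using h, by simp⟩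
  | succ j ih =>
    rw [succ_nsmul] at h
    rcases Deg.exists_lt_of_lt_add h with ⟨b, hb, h1⟩ | ⟨c, hc, h1⟩
    · obtain ⟨c, hc, h2⟩ := ih hb
      refine ⟨c, hc, h1.trans ?_⟩
      rw [succ_nsmul]
      calc b + α ≤ j • α + c + α := by gcongr
        _ = _ := by abel
    · exact ⟨c, hc, h1⟩

namespace HF
open Filter Topology

theorem frequently_dd {α α' : Deg} {f : HF} (hf : E α f) (h : α' < α) :
    ∃ᶠ δ in 𝓝[<] (0 : ℝ), dd δ f ∉ I α' := fun h' =>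
  hf.2 (mem_I_of_eventually h hf.1.1 (by simpa using h'))

theorem eventually_dd_mem {α : Deg} {f : HF} (hf : f ∈ V α) :
    ∀ᶠ δ in 𝓝[<] (0 : ℝ), dd δ f ∈ I α := by
  obtain ⟨α', h1, h2⟩ :=
    eventually_dd_of_mem_I ((Deg.nonneg α).trans_lt (Deg.lt_add_one α)) hf
  filter_upwards [h2] with δ h
  exact I_mono (Deg.lt_add_one_iff.1 h1) h

theorem N0_mem_pow {f : HF} (hf : f ∈ N0) (j : ℕ) : f ^ j ∈ N0 := by
  induction j with
  | zero => rw [pow_zero]; exact one_mem_N0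
  | succ j ih => rw [pow_succ]; exact N0_mul ih hf

theorem sub_coeff_mem_I_zero {f : HF} (hf : f ∈ V 0) : f - f.coeff 0 • (1 : HF) ∈ I 0 := by
  obtain ⟨h0, η, hη, h⟩ := mem_V_iff.1 hf
  refine mem_I_of_SI (η := -η) (by linarith) (fun q hq => ?_) 0
  have hq' : -η < q := by simpa using hq
  have h1 : (1 : HF).coeff q = if q = 0 then 1 else 0 := by
    rw [← t_zero, t, HahnSeries.coeff_single]
  rw [HahnSeries.coeff_sub, HahnSeries.coeff_smul, h1]
  rcases lt_trichotomy q 0 with hq0 | rfl | hq0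
  · have := (mem_P.1 h).2 q hq0
    rw [G_zero, Submodule.mem_bot] at this
    have := congrArg (fun y => y.coeff q) this
    simp only [restr_coeff] at this
    simpa [hq', hq0.ne] using this
  · simp
  · simp [h0 q (by simpa using hq0), hq0.ne']

theorem smul_mem_I_iff {α : Deg} {r : ℝ} (hr : r ≠ 0) {f : HF} : r • f ∈ I α ↔ f ∈ I α :=
  Submodule.smul_mem_iff _ hr

theorem one_mem_V : (1 : HF) ∈ V 0 := by
  refine P_le_V 0 (mem_P.2 ⟨one_mem_N0, fun γ hγ => ?_⟩)
  have : tr γ (1 : HF) = 0 := by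
    ext q; rw [restr_coeff, ← t_zero, t, HahnSeries.coeff_single]
    split_ifs with h1 h2
    · subst h2; simp at h1; linarith
    · rfl
    · rfl
  rw [this]; exact zero_mem _

theorem E_one : E 0 (1 : HF) := ⟨one_mem_V, fun h => by
  obtain ⟨η, hη, h1⟩ := exists_SI_of_mem_I_zero h
  have := h1 0 (by simpa using hη)
  rw [← t_zero, t, HahnSeries.coeff_single, if_pos rfl] at this
  exact one_ne_zero this⟩

theorem E_zero_mul {β : Deg} {f h : HF} (hf : E 0 f) (hh : E β h) : f * h ∉ I (0 + β) := by
  intro hm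
  rw [zero_add] at hm
  have h1 := sub_coeff_mem_I_zero hf.1
  have hr : f.coeff 0 ≠ 0 := fun h0 => hf.2 (by
    rw [h0, zero_smul ℝ (1 : HF), sub_zero] at h1; exact h1)
  apply hh.2
  rw [← smul_mem_I_iff hr]
  have h2 := sub_mem hm (I_mono (Deg.nonneg β) (I_zero_mul h1 hh.1.1))
  have e : f * h - (f - f.coeff 0 • (1 : HF)) * h = f.coeff 0 • h := by
    rw [sub_mul, sub_sub_cancel, ← HahnSeries.single_zero_mul_eq_smul, mul_one,
      HahnSeries.single_zero_mul_eq_smul]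
  rwa [e] at h2

theorem V_pow {α : Deg} {f : HF} (hf : f ∈ V α) (j : ℕ) : f ^ j ∈ V (j • α) := by
  induction j with
  | zero => rw [pow_zero, zero_nsmul]; exact one_mem_V
  | succ j ih => rw [pow_succ, succ_nsmul]; exact V_mul ih hf

theorem nsmul_smul_eq (n : ℕ) (y : HF) : (n : HF) * y = (n : ℝ) • y := by
  rw [← nsmul_eq_mul, Nat.cast_smul_eq_nsmul ℝ n y]

theorem eventually_dd_pow {α : Deg} (hα : 0 < α) {f : HF} (hf : f ∈ V α) (j : ℕ) :
    ∃ N < (j + 1) • α, ∀ᶠ δ in 𝓝[<] (0 : ℝ),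
      dd δ (f ^ (j + 1)) - ((j + 1 : ℕ) : ℝ) • (f ^ j * dd δ f) ∈ I N := by
  induction j with
  | zero =>
    refine ⟨0, by simpa using hα, Eventually.of_forall fun δ => ?_⟩
    simp
  | succ j ih =>
    obtain ⟨N, hN, h1⟩ := ih
    have hpos : 0 < (j + 1) • α + α := (add_pos_of_nonneg_of_pos (Deg.nonneg _) hα)
    obtain ⟨N', hN', h2⟩ := eventually_dd_mul (V_pow hf (j + 1)) hf hpos
    refine ⟨max (N + α) N', max_lt ?_ ?_, ?_⟩
    · rw [succ_nsmul]; exact add_lt_add_left hN α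
    · rwa [succ_nsmul]
    · filter_upwards [h1, h2] with δ h3 h4
      have := add_mem (I_mono (le_max_left (N + α) N') (I_mul_V h3 hf))
        (I_mono (le_max_right (N + α) N') h4)
      convert this using 1
      rw [← nsmul_smul_eq, ← nsmul_smul_eq]
      push_cast
      ring_nf

theorem exists_E_dd {α : Deg} {f : HF} {δ : ℝ} (h : dd δ f ∈ I α) (h' : dd δ f ∉ I 0) :
    ∃ γ < α, E γ (dd δ f) := exists_E_of_mem_I h h'

theorem E_pow_mul_aux {α : Deg} (hα : 0 < α)
    (ih : ∀ α' < α, ∀ β f h, E α' f → E β h → f * h ∉ I (α' + β))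
    {f : HF} (hf : E α f) {β : Deg} {h : HF} (hh : E β h) (j : ℕ) :
    f ^ j * h ∉ I (j • α + β) := by
  induction β using WellFoundedLT.induction generalizing h j with
  | ind β ihβ =>
  induction j with
  | zero => rw [pow_zero, zero_nsmul, one_mul, zero_add]; exact hh.2
  | succ j ihj =>
    intro hm
    have hjh : E (j • α + β) (f ^ j * h) := ⟨V_mul (V_pow hf.1 j) hh.1, ihj⟩
    have hpos' : 0 < (j + 1) • α := by
      rw [succ_nsmul]; exact add_pos_of_nonneg_of_pos (Deg.nonneg _) hα
    have hpos : 0 < (j + 1) • α + β := add_pos_of_pos_of_nonneg hpos' (Deg.nonneg _)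
    obtain ⟨A, hA, h1⟩ := eventually_dd_of_mem_I hpos hm
    obtain ⟨N1, hN1, h2⟩ := eventually_dd_pow hα hf.1 j
    obtain ⟨N2, hN2, h3⟩ := eventually_dd_mul (V_pow hf.1 (j + 1)) hh.1 hpos
    obtain ⟨B, hB, hAB, hN1B, hN2B⟩ :
        ∃ B < (j + 1) • α + β, A ≤ B ∧ N1 + β ≤ B ∧ N2 ≤ B :=
      ⟨max A (max (N1 + β) N2), max_lt hA (max_lt (add_lt_add_left hN1 β) hN2),
        le_max_left _ _, (le_max_left _ _).trans (le_max_right _ _),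
        (le_max_right _ _).trans (le_max_right _ _)⟩
    have hev : ∀ᶠ δ in 𝓝[<] (0 : ℝ), ((j + 1 : ℕ) : ℝ) • (dd δ f * (f ^ j * h)) +
        f ^ (j + 1) * dd δ h ∈ I B ∧ dd δ f ∈ I α ∧ dd δ h ∈ I β := by
      filter_upwards [h1, h2, h3, eventually_dd_mem hf.1, eventually_dd_mem hh.1]
        with δ h4 h5 h6 h7 h8
      refine ⟨?_, h7, h8⟩
      have := sub_mem (sub_mem (I_mono hAB h4) (I_mono hN1B (I_mul_V h5 hh.1))) (I_mono hN2B h6)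
      convert this using 1
      rw [← nsmul_smul_eq, ← nsmul_smul_eq]
      ring
    obtain ⟨δ, hXY, hδ, hδf, hδh⟩ : ∃ δ, (dd δ f * (f ^ j * h) ∉ I B ∨ f ^ (j + 1) * dd δ h ∉ I B) ∧
        ((j + 1 : ℕ) : ℝ) • (dd δ f * (f ^ j * h)) +
        f ^ (j + 1) * dd δ h ∈ I B ∧ dd δ f ∈ I α ∧ dd δ h ∈ I β := by
      rcases Deg.exists_lt_of_lt_add hB with ⟨b, hb, hBb⟩ | ⟨c, hc, hBc⟩
      · obtain ⟨c, hc, hbc⟩ := Deg.exists_lt_of_lt_nsmul j hb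
        obtain ⟨δ, h4, h5⟩ := ((frequently_dd hf hc).and_eventually hev).exists
        refine ⟨δ, .inl fun hX => ?_, h5⟩
        obtain ⟨γ, hγ, h6⟩ := exists_E_dd h5.2.1 fun h => h4 (I_mono (Deg.nonneg c) h)
        have hcγ : c ≤ γ := by
          by_contra! hlt
          exact h4 (V_le_I hlt h6.1)
        refine ih γ hγ _ _ _ h6 hjh (I_mono (hBb.trans ?_) hX)
        calc b + β ≤ j • α + γ + β := by gcongr; exact hbc.trans (by gcongr)
          _ = _ := by abel
      · obtain ⟨δ, h4, h5⟩ := ((frequently_dd hh hc).and_eventually hev).exists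
        refine ⟨δ, .inr fun hY => ?_, h5⟩
        obtain ⟨ε, hε, h6⟩ := exists_E_dd h5.2.2 fun h => h4 (I_mono (Deg.nonneg c) h)
        have hcε : c ≤ ε := by
          by_contra! hlt
          exact h4 (V_le_I hlt h6.1)
        exact ihβ ε hε h6 (j + 1) (I_mono (hBc.trans (by gcongr)) hY)
    have hj0 : ((j + 1 : ℕ) : ℝ) ≠ 0 := by positivity
    have hX : dd δ f * (f ^ j * h) ∉ I B := by
      rcases hXY with h' | h'
      · exact h'
      · exact fun hX => h' (by simpa using sub_mem hδ ((smul_mem_I_iff hj0).2 hX))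
    have hY : f ^ (j + 1) * dd δ h ∉ I B := fun hY =>
      hX ((smul_mem_I_iff hj0).1 (by simpa using sub_mem hδ hY))
    obtain ⟨γ, hγ, hEf⟩ := exists_E_dd hδf fun h0 =>
      hX (I_mono (Deg.nonneg B) (I_zero_mul h0 hjh.1.1))
    obtain ⟨ε, hε, hEh⟩ := exists_E_dd hδh fun h0 =>
      hY (I_mono (Deg.nonneg B) (by rw [mul_comm]; exact I_zero_mul h0 (N0_mem_pow hf.1.1 _)))
    have hVX := V_mul hEf.1 hjh.1
    have hEX : E (γ + (j • α + β)) (dd δ f * (f ^ j * h)) := ⟨hVX, ih γ hγ _ _ _ hEf hjh⟩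
    have hVY := V_mul (V_pow hf.1 (j + 1)) hEh.1
    have hBD : B ≤ (j + 1) • α + ε := by
      by_contra! hlt
      exact hY (V_le_I hlt hVY)
    have hXD : γ + (j • α + β) ≤ (j + 1) • α + ε := by
      refine hEX.le ((smul_mem_I_iff hj0).1 ?_)
      have := sub_mem (I_mono (hBD.trans (Deg.lt_add_one _).le) hδ) hVY
      simpa using this
    have hFX : f ^ (j + 1) * (dd δ f * (f ^ j * h)) ∈ I ((j + 1) • α + ((j + 1) • α + ε)) := by
      have := V_mul_I (V_mul (V_pow hf.1 j) hEf.1) hm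
      refine I_mono ?_ (by convert this using 1; ring)
      calc j • α + γ + ((j + 1) • α + β) = (j + 1) • α + (γ + (j • α + β)) := by abel
        _ ≤ _ := by gcongr
    have hFY : f ^ (j + 1) * (f ^ (j + 1) * dd δ h) ∈ I ((j + 1) • α + ((j + 1) • α + ε)) := by
      have h9 := V_mul_I (V_pow hf.1 (j + 1)) hδ
      have h10 := sub_mem (I_mono (by gcongr) h9) ((smul_mem_I_iff hj0).2 hFX)
      convert h10 using 1
      rw [← nsmul_smul_eq, ← nsmul_smul_eq]
      ring
    refine ihβ ε hε hEh ((j + 1) + (j + 1)) ?_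
    rw [pow_add, mul_assoc, add_nsmul, add_assoc]
    exact hFY

theorem E.mul_notMem {α β : Deg} {f h : HF} (hf : E α f) (hh : E β h) : f * h ∉ I (α + β) := by
  induction α using WellFoundedLT.induction generalizing f h β with
  | ind α ih =>
  rcases (Deg.nonneg α).eq_or_lt with rfl | hα
  · exact E_zero_mul hf hh
  · have := E_pow_mul_aux hα (fun α' h' β f h hf hh => ih α' h' hf hh) hf hh 1
    rwa [pow_one, one_nsmul] at this

theorem E.mul {α β : Deg} {f h : HF} (hf : E α f) (hh : E β h) : E (α + β) (f * h) :=
  ⟨V_mul hf.1 hh.1, hf.mul_notMem hh⟩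

end HF

namespace HF
open Filter Topology

theorem E.ne_zero {α : Deg} {s : HF} (h : E α s) : s ≠ 0 := fun h0 => h.2 (h0 ▸ zero_mem _)

/-- Quotients of germs of equal degree. -/
noncomputable def OO : Subring HF where
  carrier := {y | ∃ α s, E α s ∧ y * s ∈ V α}
  mul_mem' := by
    rintro y z ⟨α, s, hs, h⟩ ⟨β, u, hu, h'⟩
    refine ⟨α + β, s * u, hs.mul hu, ?_⟩
    rw [mul_mul_mul_comm]; exact V_mul h h'
  add_mem' := by
    rintro y z ⟨α, s, hs, h⟩ ⟨β, u, hu, h'⟩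
    refine ⟨α + β, s * u, hs.mul hu, ?_⟩
    have e : (y + z) * (s * u) = (y * s) * u + s * (z * u) := by ring
    rw [e]; exact add_mem (V_mul h hu.1) (V_mul hs.1 h')
  one_mem' := ⟨0, 1, E_one, by rw [mul_one]; exact one_mem_V⟩
  zero_mem' := ⟨0, 1, E_one, by rw [zero_mul]; exact zero_mem _⟩
  neg_mem' := by
    rintro y ⟨α, s, hs, h⟩
    exact ⟨α, s, hs, (neg_mul y s).symm ▸ neg_mem h⟩

theorem single_zero_mem_OO (r : ℝ) : HahnSeries.C r ∈ OO := by
  refine ⟨0, 1, E_one, ?_⟩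
  rw [HahnSeries.C_apply, HahnSeries.single_zero_mul_eq_smul]
  exact Submodule.smul_mem _ _ one_mem_V

/-- Quotients with numerator of smaller degree than the denominator. -/
noncomputable def MM : Ideal OO where
  carrier := {y | ∃ α s, E α s ∧ (y : HF) * s ∈ I α}
  add_mem' := by
    rintro y z ⟨α, s, hs, h⟩ ⟨β, u, hu, h'⟩
    refine ⟨α + β, s * u, hs.mul hu, ?_⟩
    have e : ((y + z : OO) : HF) * (s * u) = (y * s) * u + s * (z * u) := by push_cast; ring
    rw [e]; exact add_mem (I_mul_V h hu.1) (V_mul_I hs.1 h')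
  zero_mem' := ⟨0, 1, E_one, by simp⟩
  smul_mem' := by
    rintro ⟨y, α, s, hs, h⟩ z ⟨β, u, hu, h'⟩
    refine ⟨α + β, s * u, hs.mul hu, ?_⟩
    simp only [smul_eq_mul, MulMemClass.coe_mul]
    rw [mul_mul_mul_comm]; exact V_mul_I h h'

theorem mem_MM_iff {α : Deg} {s : HF} (hs : E α s) (y : OO) (hy : (y : HF) * s ∈ V α) :
    y ∈ MM ↔ (y : HF) * s ∈ I α := by
  refine ⟨?_, fun h => ⟨α, s, hs, h⟩⟩
  rintro ⟨β, u, hu, h⟩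
  by_contra h'
  have h1 : E α ((y : HF) * s) := ⟨hy, h'⟩
  have h2 := (h1.mul hu).2
  apply h2
  have e : (y : HF) * s * u = s * (y * u) := by ring
  rw [e]; exact V_mul_I hs.1 h

instance MM_isMaximal : MM.IsMaximal := by
  rw [Ideal.isMaximal_iff]
  refine ⟨fun h => ?_, fun J y hJ hy hyJ => ?_⟩
  · rw [mem_MM_iff E_one _ (by simpa using one_mem_V)] at h
    exact E_one.2 (by simpa using h)
  · obtain ⟨y, hyO⟩ := y
    obtain ⟨α, s, hs, h⟩ := id hyO
    rw [mem_MM_iff hs ⟨y, hyO⟩ h] at hy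
    have hE : E α (y * s) := ⟨h, hy⟩
    have hy0 : y ≠ 0 := fun h0 => hE.ne_zero (by rw [h0, zero_mul])
    have hinv : y⁻¹ ∈ OO := ⟨α, y * s, hE, by rw [inv_mul_cancel_left₀ hy0]; exact hs.1⟩
    have h1 : (⟨y⁻¹, hinv⟩ : OO) * ⟨y, hyO⟩ = 1 := Subtype.ext (inv_mul_cancel₀ hy0)
    exact h1 ▸ J.mul_mem_left ⟨y⁻¹, hinv⟩ hyJ

/-- The residue field. -/
def Kap := OO ⧸ MM

/-- The field structure on the residue field. -/
noncomputable def kapField : Field Kap := Ideal.Quotient.field MM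

noncomputable instance : Field Kap := kapField

/-- The residue map. -/
noncomputable def resid : OO →+* Kap := Ideal.Quotient.mk MM

theorem resid_eq_zero_iff {y : OO} : resid y = 0 ↔ y ∈ MM := Ideal.Quotient.eq_zero_iff_mem

/-- Constants in the residue field. -/
noncomputable def const : ℝ →+* Kap := resid.comp (HahnSeries.C.codRestrict OO single_zero_mem_OO)

noncomputable instance : Module ℝ Kap := Module.compHom Kap const

theorem smul_eq_const_mul (r : ℝ) (k : Kap) : r • k = const r * k := rfl

instance : CharZero Kap :=
  charZero_of_injective_ringHom const.injective

/-- The residue class of `y`. -/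
noncomputable def cls (y : HF) : Kap := if h : y ∈ OO then resid ⟨y, h⟩ else 0

theorem div_mem_OO {α : Deg} {s y : HF} (hs : E α s) (hy : y ∈ V α) : y / s ∈ OO :=
  ⟨α, s, hs, by rwa [div_mul_cancel₀ _ hs.ne_zero]⟩

theorem cls_mul {y z : HF} (hy : y ∈ OO) (hz : z ∈ OO) : cls (y * z) = cls y * cls z := by
  rw [cls, cls, cls, dif_pos hy, dif_pos hz, dif_pos (OO.mul_mem hy hz), ← map_mul]; rfl

theorem cls_add {y z : HF} (hy : y ∈ OO) (hz : z ∈ OO) : cls (y + z) = cls y + cls z := by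
  rw [cls, cls, cls, dif_pos hy, dif_pos hz, dif_pos (OO.add_mem hy hz), ← map_add]; rfl

theorem cls_one : cls 1 = 1 := by
  rw [cls, dif_pos OO.one_mem]; exact map_one resid

theorem cls_smul (r : ℝ) {y : HF} (hy : y ∈ OO) : cls (r • y) = r • cls y := by
  have h : cls (HahnSeries.C r) = const r := by
    rw [cls, dif_pos (single_zero_mem_OO r)]; rfl
  rw [← HahnSeries.single_zero_mul_eq_smul, ← HahnSeries.C_apply,
    cls_mul (single_zero_mem_OO r) hy, h, smul_eq_const_mul]

theorem cls_div_eq_zero_iff {α : Deg} {s y : HF} (hs : E α s) (hy : y ∈ V α) :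
    cls (y / s) = 0 ↔ y ∈ I α := by
  rw [cls, dif_pos (div_mem_OO hs hy), resid_eq_zero_iff, mem_MM_iff hs]
  · simp only [div_mul_cancel₀ _ hs.ne_zero]
  · simpa only [div_mul_cancel₀ _ hs.ne_zero]

theorem exists_leading {α : Deg} {s : HF} (hs : E α s) :
    ∃ ρ : HF →ₗ[ℝ] Kap, ∀ y ∈ V α, ρ y = cls (y / s) := by
  let f : V α →ₗ[ℝ] Kap :=
    { toFun := fun y => cls (y / s)
      map_add' := fun y z => by
        rw [← cls_add (div_mem_OO hs y.2) (div_mem_OO hs z.2), ← add_div]; rfl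
      map_smul' := fun r y => by
        rw [RingHom.id_apply, ← cls_smul r (div_mem_OO hs y.2)]
        congr 1
        rw [Submodule.coe_smul, div_eq_mul_inv, div_eq_mul_inv,
          ← HahnSeries.single_zero_mul_eq_smul, mul_assoc, HahnSeries.single_zero_mul_eq_smul] }
  obtain ⟨ρ, hρ⟩ := f.exists_extend
  exact ⟨ρ, fun y hy => congrArg (fun g => g ⟨y, hy⟩) hρ⟩

/-- The leading coefficient of a germ relative to `s`. -/
noncomputable def lead (s : HF) : HF →ₗ[ℝ] Kap :=
  if h : ∃ α, E α s then (exists_leading h.choose_spec).choose else 0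

theorem lead_apply {α : Deg} {s y : HF} (hs : E α s) (hy : y ∈ V α) : lead s y = cls (y / s) := by
  have h : ∃ α, E α s := ⟨α, hs⟩
  rw [lead, dif_pos h]
  refine (exists_leading h.choose_spec).choose_spec y ?_
  rwa [h.choose_spec.unique hs]

theorem lead_eq_zero_iff {α : Deg} {s y : HF} (hs : E α s) (hy : y ∈ V α) :
    lead s y = 0 ↔ y ∈ I α := by
  rw [lead_apply hs hy, cls_div_eq_zero_iff hs hy]

theorem lead_mul {α β : Deg} {s u y z : HF} (hs : E α s) (hu : E β u) (hy : y ∈ V α)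
    (hz : z ∈ V β) : lead (s * u) (y * z) = lead s y * lead u z := by
  rw [lead_apply hs hy, lead_apply hu hz, lead_apply (hs.mul hu) (V_mul hy hz),
    ← cls_mul (div_mem_OO hs hy) (div_mem_OO hu hz), div_mul_div_comm]

theorem lead_one_one : lead 1 1 = 1 := by
  rw [lead_apply E_one one_mem_V, div_one, cls_one]

end HF

/-- Functions on words in real letters. -/
def Wd (κ : Type) : Type := List ℝ → κ

namespace Wd
open Filter Topology

variable {κ : Type} [Field κ]

noncomputable instance : AddCommGroup (Wd κ) := inferInstanceAs (AddCommGroup (List ℝ → κ))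

noncomputable instance : Module κ (Wd κ) := inferInstanceAs (Module κ (List ℝ → κ))

/-- Removal of a first letter. -/
noncomputable def pd (γ : ℝ) : Wd κ →ₗ[κ] Wd κ where
  toFun f w := f (γ :: w)
  map_add' _ _ := rfl
  map_smul' _ _ := rfl

theorem pd_apply (γ : ℝ) (f : Wd κ) (w : List ℝ) : pd γ f w = f (γ :: w) := rfl

theorem add_apply (f g : Wd κ) (w : List ℝ) : (f + g) w = f w + g w := rfl

theorem sub_apply (f g : Wd κ) (w : List ℝ) : (f - g) w = f w - g w := rfl

theorem smul_apply (c : κ) (f : Wd κ) (w : List ℝ) : (c • f) w = c * f w := rfl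

theorem zero_apply (w : List ℝ) : (0 : Wd κ) w = 0 := rfl

/-- The shuffle product evaluated at a word. -/
noncomputable def mulAt : List ℝ → Wd κ → Wd κ → κ
  | [], f, g => f [] * g []
  | γ :: w, f, g => mulAt w (pd γ f) g + mulAt w f (pd γ g)

noncomputable instance : Mul (Wd κ) := ⟨fun f g w => mulAt w f g⟩

noncomputable instance : One (Wd κ) := ⟨fun w => if w = [] then 1 else 0⟩

theorem mul_nil (f g : Wd κ) : (f * g) [] = f [] * g [] := rfl

theorem mul_cons (f g : Wd κ) (γ : ℝ) (w : List ℝ) :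
    (f * g) (γ :: w) = (pd γ f * g) w + (f * pd γ g) w := rfl

theorem pd_mul (γ : ℝ) (f g : Wd κ) : pd γ (f * g) = pd γ f * g + f * pd γ g := rfl

theorem one_nil : (1 : Wd κ) [] = 1 := if_pos rfl

theorem pd_one (γ : ℝ) : pd γ (1 : Wd κ) = 0 :=
  funext fun w => if_neg (c := γ :: w = []) (t := (1 : κ)) (List.cons_ne_nil γ w)

theorem zero_mul_at (w : List ℝ) (f : Wd κ) : ((0 : Wd κ) * f) w = 0 := by
  induction w generalizing f with
  | nil => rw [mul_nil, zero_apply, zero_mul]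
  | cons γ w ih => rw [mul_cons, map_zero, ih, ih, add_zero]

theorem one_mul_at (w : List ℝ) (f : Wd κ) : ((1 : Wd κ) * f) w = f w := by
  induction w generalizing f with
  | nil => rw [mul_nil, one_nil, one_mul]
  | cons γ w ih => rw [mul_cons, pd_one, zero_mul_at, ih, zero_add, pd_apply]

theorem mul_comm_at (w : List ℝ) (f g : Wd κ) : (f * g) w = (g * f) w := by
  induction w generalizing f g with
  | nil => rw [mul_nil, mul_nil, mul_comm]
  | cons γ w ih => rw [mul_cons, mul_cons, ih, ih f, add_comm]

theorem add_mul_at (w : List ℝ) (f g h : Wd κ) : ((f + g) * h) w = (f * h + g * h) w := by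
  induction w generalizing f g h with
  | nil => rw [add_apply, mul_nil, mul_nil, mul_nil, add_apply, add_mul]
  | cons γ w ih =>
    rw [add_apply, mul_cons, mul_cons, mul_cons, map_add, ih, ih, add_apply, add_apply]; ring

theorem smul_mul_at (w : List ℝ) (c : κ) (f h : Wd κ) : ((c • f) * h) w = (c • (f * h)) w := by
  induction w generalizing f h with
  | nil => rw [smul_apply, mul_nil, mul_nil, smul_apply, mul_assoc]
  | cons γ w ih =>
    rw [smul_apply, mul_cons, mul_cons, map_smul, ih, ih, smul_apply, smul_apply]; ring

theorem mul_assoc_at (w : List ℝ) (f g h : Wd κ) : (f * g * h) w = (f * (g * h)) w := by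
  induction w generalizing f g h with
  | nil => simp only [mul_nil, mul_assoc]
  | cons γ w ih =>
    have e : ∀ f g h : Wd κ, (f * (g + h)) w = (f * g) w + (f * h) w := fun f g h => by
      rw [mul_comm_at, add_mul_at, add_apply, mul_comm_at, mul_comm_at w h]
    rw [mul_cons, mul_cons, pd_mul, pd_mul, add_mul_at, e, add_apply, ih, ih, ih, add_assoc]

noncomputable instance : CommRing (Wd κ) :=
  { (inferInstance : AddCommGroup (Wd κ)) with
    mul := (· * ·)
    one := 1
    mul_assoc := fun f g h => funext fun w => mul_assoc_at w f g h
    one_mul := fun f => funext fun w => one_mul_at w f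
    mul_one := fun f => funext fun w => (mul_comm_at w f 1).trans (one_mul_at w f)
    zero_mul := fun f => funext fun w => zero_mul_at w f
    mul_zero := fun f => funext fun w => (mul_comm_at w f 0).trans (zero_mul_at w f)
    mul_comm := fun f g => funext fun w => mul_comm_at w f g
    right_distrib := fun f g h => funext fun w => add_mul_at w f g h
    left_distrib := fun f g h => funext fun w => by
      show (f * (g + h)) w = (f * g + f * h) w
      rw [mul_comm_at, add_mul_at, add_apply, add_apply, mul_comm_at, mul_comm_at w h] }

noncomputable instance : Algebra κ (Wd κ) :=
  Algebra.ofModule (fun c f g => funext fun w => smul_mul_at w c f g) fun c f g => by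
    rw [mul_comm, mul_comm f]; exact funext fun w => smul_mul_at w c g f

/-- The filtration of functions on words by their germs at `0`. -/
noncomputable def O : ℕ → Submodule κ (Wd κ)
  | 0 => ⊤
  | k + 1 =>
    { carrier := {f | f [] = 0 ∧ ∀ᶠ γ in 𝓝[<] (0 : ℝ), pd γ f ∈ O k}
      add_mem' := by
        rintro f g ⟨h1, h2⟩ ⟨h3, h4⟩
        refine ⟨by rw [add_apply, h1, h3, add_zero], ?_⟩
        filter_upwards [h2, h4] with γ h h'
        rw [map_add]; exact add_mem h h'
      zero_mem' := ⟨rfl, Eventually.of_forall fun γ => by rw [map_zero]; exact zero_mem _⟩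
      smul_mem' := by
        rintro c f ⟨h1, h2⟩
        refine ⟨by rw [smul_apply, h1, mul_zero], ?_⟩
        filter_upwards [h2] with γ h
        rw [map_smul]; exact Submodule.smul_mem _ c h }

theorem mem_O_zero (f : Wd κ) : f ∈ O 0 := Submodule.mem_top

theorem mem_O_one {f : Wd κ} : f ∈ O 1 ↔ f [] = 0 :=
  ⟨fun h => h.1, fun h => ⟨h, Eventually.of_forall fun _ => mem_O_zero _⟩⟩

theorem O_succ_le (k : ℕ) : (O (k + 1) : Submodule κ (Wd κ)) ≤ O k := by
  induction k with
  | zero => exact fun f _ => mem_O_zero f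
  | succ k ih => exact fun f hf => ⟨hf.1, hf.2.mono fun γ h => ih h⟩

theorem O_anti {k l : ℕ} (h : k ≤ l) : (O l : Submodule κ (Wd κ)) ≤ O k :=
  antitone_nat_of_succ_le O_succ_le h

theorem eventually_pd_mem {a : ℕ} {f : Wd κ} (hf : f ∈ O a) :
    ∀ᶠ γ in 𝓝[<] (0 : ℝ), pd γ f ∈ O (a - 1) := by
  cases a with
  | zero => exact Eventually.of_forall fun _ => mem_O_zero _
  | succ a => exact hf.2

theorem O_mul {n a b : ℕ} (h : n ≤ a + b) {f g : Wd κ} (hf : f ∈ O a) (hg : g ∈ O b) :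
    f * g ∈ O n := by
  induction n generalizing a b f g with
  | zero => exact mem_O_zero _
  | succ n ih =>
    refine ⟨?_, ?_⟩
    · rw [mul_nil]
      rcases Nat.eq_zero_or_pos a with rfl | ha
      · rw [(O_anti (k := 1) (by omega) hg : g ∈ O 1).1, mul_zero]
      · rw [(O_anti (k := 1) (by omega) hf : f ∈ O 1).1, zero_mul]
    · filter_upwards [eventually_pd_mem hf, eventually_pd_mem hg] with γ h1 h2
      rw [pd_mul]
      exact add_mem (ih (by omega) h1 hg) (ih (by omega) hf h2)

theorem O_mul_left {n : ℕ} (f : Wd κ) {g : Wd κ} (hg : g ∈ O n) : f * g ∈ O n :=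
  O_mul (by omega) (mem_O_zero f) hg

theorem O_pow {m : ℕ} {f : Wd κ} (hf : f ∈ O m) (j : ℕ) : f ^ j ∈ O (j * m) := by
  induction j with
  | zero => rw [zero_mul]; exact mem_O_zero _
  | succ j ih => rw [pow_succ]; exact O_mul (by rw [Nat.succ_mul]) ih hf

theorem one_notMem_O : (1 : Wd κ) ∉ O 1 := fun h => one_ne_zero (one_nil.symm.trans (mem_O_one.1 h))

theorem pd_pow (γ : ℝ) (f : Wd κ) (j : ℕ) :
    pd γ (f ^ (j + 1)) = (j + 1 : κ) • (f ^ j * pd γ f) := by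
  induction j with
  | zero => simp
  | succ j ih =>
    have e : f ^ j * pd γ f * f = f ^ (j + 1) * pd γ f := by ring
    rw [pow_succ, pd_mul, ih, smul_mul_assoc, e]
    push_cast
    module

theorem sub_smul_one_mem (f : Wd κ) : f - f [] • (1 : Wd κ) ∈ O 1 :=
  mem_O_one.2 (by rw [sub_apply, smul_apply, one_nil, mul_one, sub_self])

theorem mul_notMem_of_nil_ne_zero {n : ℕ} {f g : Wd κ} (hf : f [] ≠ 0) (hg : g ∈ O n)
    (hg' : g ∉ O (n + 1)) : f * g ∉ O (n + 1) := fun h => hg' <| by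
  have h1 : (f - f [] • (1 : Wd κ)) * g ∈ O (n + 1) := O_mul (by omega) (sub_smul_one_mem f) hg
  have h2 := sub_mem h h1
  rw [sub_mul, sub_sub_cancel, smul_one_mul] at h2
  exact (Submodule.smul_mem_iff _ hf).1 h2

theorem exists_exact {m : ℕ} {f : Wd κ} (hf : f ∉ O (m + 1)) :
    ∃ k ≤ m, f ∈ O k ∧ f ∉ O (k + 1) := by
  induction m with
  | zero => exact ⟨0, le_rfl, mem_O_zero f, hf⟩
  | succ m ih =>
    by_cases h : f ∈ O (m + 1)
    · exact ⟨m + 1, le_rfl, h, hf⟩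
    · obtain ⟨k, h1, h2⟩ := ih h
      exact ⟨k, by omega, h2⟩

theorem pow_mul_notMem {m : ℕ} {f : Wd κ} (hf : f ∈ O (m + 1))
    (hpow : ∀ j, f ^ j ∉ O (j * (m + 1) + 1)) {n : ℕ} {h : Wd κ} (hh : h ∈ O n)
    (hh' : h ∉ O (n + 1)) (j : ℕ) : f ^ j * h ∉ O (j * (m + 1) + n + 1) := by
  induction n generalizing h j with
  | zero =>
    rw [mul_comm (f ^ j)]
    exact mul_notMem_of_nil_ne_zero (fun h0 => hh' (mem_O_one.2 h0)) (O_pow hf j) (hpow j)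
  | succ n ih =>
    intro hm
    apply hh'
    refine ⟨hh.1, ?_⟩
    filter_upwards [hh.2, hm.2, hf.2] with γ h1 h2 h3
    by_contra h4
    refine ih h1 h4 (j + 1) ?_
    cases j with
    | zero =>
      rw [pow_zero, one_mul] at h2
      exact absurd (O_anti (by omega) h2) h4
    | succ j =>
      rw [pd_mul] at h2
      have h5 : pd γ (f ^ (j + 1)) * h * f ∈ O ((j + 1 + 1) * (m + 1) + n + 1) := by
        rw [pd_pow, smul_mul_assoc, smul_mul_assoc]
        apply Submodule.smul_mem
        have e : f ^ j * pd γ f * h * f = pd γ f * (f ^ (j + 1) * h) := by ring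
        rw [e]
        exact O_mul (by ring_nf; omega) h3 hm
      have h6 : (pd γ (f ^ (j + 1)) * h + f ^ (j + 1) * pd γ h) * f
          ∈ O ((j + 1 + 1) * (m + 1) + n + 1) := O_mul (by ring_nf; omega) h2 hf
      have h7 := sub_mem h6 h5
      convert h7 using 1
      ring

variable [CharZero κ]

theorem pow_notMem {m : ℕ} {f : Wd κ} (hf : f ∈ O (m + 1)) (hf' : f ∉ O (m + 2))
    (ih : ∀ {n : ℕ} {g h : Wd κ}, g ∈ O m → g ∉ O (m + 1) → h ∈ O n → h ∉ O (n + 1) →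
      g * h ∉ O (m + n + 1)) (j : ℕ) : f ^ j ∉ O (j * (m + 1) + 1) := by
  induction j with
  | zero => simpa using one_notMem_O
  | succ j ihj =>
    intro h
    apply hf'
    refine ⟨hf.1, ?_⟩
    filter_upwards [hf.2, h.2] with γ h1 h2
    by_contra h3
    refine ih h1 h3 (O_pow hf j) ihj ?_
    rw [pd_pow, Submodule.smul_mem_iff _ (by exact_mod_cast j.succ_ne_zero),
      mul_comm (f ^ j)] at h2
    refine O_anti ?_ h2
    rw [Nat.succ_mul]; omega

theorem mul_notMem_of_mem {m n : ℕ} {f h : Wd κ} (hf : f ∈ O m) (hf' : f ∉ O (m + 1)) (hh : h ∈ O n)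
    (hh' : h ∉ O (n + 1)) : f * h ∉ O (m + n + 1) := by
  induction m generalizing f h n with
  | zero =>
    rw [zero_add]
    exact mul_notMem_of_nil_ne_zero (fun h0 => hf' (mem_O_one.2 h0)) hh hh'
  | succ m ih =>
    simpa using pow_mul_notMem hf (pow_notMem hf hf' ih) hh hh' 1

theorem mul_notMem {m n : ℕ} {f h : Wd κ} (hf : f ∉ O (m + 1)) (hh : h ∉ O (n + 1)) :
    f * h ∉ O (m + n + 1) := by
  obtain ⟨k, h1, h2, h3⟩ := exists_exact hf
  obtain ⟨l, h4, h5, h6⟩ := exists_exact hh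
  exact fun h => mul_notMem_of_mem h2 h3 h5 h6 (O_anti (by omega) h)

end Wd

namespace Wd
open Filter Topology

variable {κ : Type} [Field κ]

/-- The right derivation attached to a functional on functions of one letter. -/
noncomputable def rd (L : (ℝ → κ) →ₗ[κ] κ) : Wd κ →ₗ[κ] Wd κ where
  toFun f w := L fun γ => f (w ++ [γ])
  map_add' _ _ := funext fun _ => map_add L _ _
  map_smul' c _ := funext fun _ => map_smul L c _

theorem pd_rd (L : (ℝ → κ) →ₗ[κ] κ) (f : Wd κ) (γ : ℝ) : pd γ (rd L f) = rd L (pd γ f) := rfl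

theorem rd_mul_at (L : (ℝ → κ) →ₗ[κ] κ) (w : List ℝ) (f g : Wd κ) :
    rd L (f * g) w = (rd L f * g + f * rd L g) w := by
  induction w generalizing f g with
  | nil =>
    have e : (fun γ => (f * g) [γ])
        = g [] • (fun γ => f [γ]) + f [] • (fun γ => g [γ]) := by
      funext γ
      show (f * g) [γ] = g [] * f [γ] + f [] * g [γ]
      rw [mul_cons, mul_nil, mul_nil, mul_comm (g [])]
      rfl
    show L (fun γ => (f * g) [γ]) = L (fun γ => f [γ]) * g [] + f [] * L (fun γ => g [γ])
    rw [e, map_add, map_smul, map_smul, smul_eq_mul, smul_eq_mul, mul_comm (g [])]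
  | cons γ w ih =>
    show pd γ (rd L (f * g)) w = pd γ (rd L f * g + f * rd L g) w
    rw [pd_rd, pd_mul, map_add, map_add, pd_mul, pd_mul, add_apply, ih, ih,
      pd_rd, pd_rd, add_apply, add_apply, add_apply, add_apply, add_apply]
    ring

theorem rd_mul (L : (ℝ → κ) →ₗ[κ] κ) (f g : Wd κ) : rd L (f * g) = rd L f * g + f * rd L g :=
  funext fun w => rd_mul_at L w f g

theorem rd_mem_O {L : (ℝ → κ) →ₗ[κ] κ}
    (hL : ∀ p : ℝ → κ, (∀ᶠ γ in 𝓝[<] (0 : ℝ), p γ = 0) → L p = 0) {k : ℕ} {f : Wd κ}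
    (hf : f ∈ O (k + 1)) : rd L f ∈ O k := by
  induction k generalizing f with
  | zero => exact mem_O_zero _
  | succ k ih => exact ⟨hL _ (hf.2.mono fun γ h => h.1), hf.2.mono fun γ h => ih h⟩

/-- The function supported on one-letter words `-1/n`. -/
noncomputable def X : Wd κ
  | [γ] => if ∃ n : ℕ, γ = -1 / (n + 1) then 1 else 0
  | _ => 0

theorem X_nil : (X : Wd κ) [] = 0 := rfl

theorem pd_X_of_exists {γ : ℝ} (h : ∃ n : ℕ, γ = -1 / (n + 1)) : pd γ (X : Wd κ) = 1 := by
  funext w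
  rw [pd_apply]
  cases w with
  | nil => rw [one_nil]; exact if_pos h
  | cons a w => exact (if_neg (c := a :: w = []) (t := (1 : κ)) (List.cons_ne_nil a w)).symm

theorem pd_X_of_not {γ : ℝ} (h : ¬ ∃ n : ℕ, γ = -1 / (n + 1)) : pd γ (X : Wd κ) = 0 := by
  funext w
  rw [pd_apply]
  cases w with
  | nil => exact if_neg h
  | cons a w => rfl

theorem X_mem_O : (X : Wd κ) ∈ O 1 := mem_O_one.2 rfl

theorem tendsto_neg_inv : Tendsto (fun n : ℕ => -1 / ((n : ℝ) + 1)) atTop (𝓝[<] 0) := by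
  refine tendsto_nhdsWithin_iff.2 ⟨?_, Eventually.of_forall fun n => ?_⟩
  · have := (tendsto_one_div_add_atTop_nhds_zero_nat (𝕜 := ℝ)).neg
    simpa [neg_div] using this
  · have : (0 : ℝ) < n + 1 := by positivity
    exact div_neg_of_neg_of_pos (by norm_num) this

theorem exists_functional : ∃ L : (ℝ → κ) →ₗ[κ] κ,
    (∀ p : ℝ → κ, (∀ᶠ γ in 𝓝[<] (0 : ℝ), p γ = 0) → L p = 0) ∧ rd L (X : Wd κ) = 1 := by
  let N : Submodule κ (ℝ → κ) :=
    { carrier := {p | ∀ᶠ γ in 𝓝[<] (0 : ℝ), p γ = 0}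
      add_mem' := fun {p q} h h' => by
        show ∀ᶠ γ in 𝓝[<] (0 : ℝ), (p + q) γ = 0
        filter_upwards [h, h'] with γ h1 h2
        rw [Pi.add_apply, h1, h2, add_zero]
      zero_mem' := by
        show ∀ᶠ γ in 𝓝[<] (0 : ℝ), (0 : ℝ → κ) γ = 0
        exact Eventually.of_forall fun _ => rfl
      smul_mem' := fun c p h => by
        show ∀ᶠ γ in 𝓝[<] (0 : ℝ), (c • p) γ = 0
        filter_upwards [h] with γ h1
        rw [Pi.smul_apply, h1, smul_zero] }
  have hN : (fun γ => (X : Wd κ) [γ]) ∉ N := fun h => by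
    obtain ⟨n, hn⟩ := (tendsto_neg_inv.eventually h).exists
    have h1 : (X : Wd κ) [-1 / ((n : ℝ) + 1)] = 1 := if_pos ⟨n, rfl⟩
    exact one_ne_zero (h1.symm.trans hn)
  obtain ⟨L, h1, h2⟩ := LinearMap.exists_extend_of_notMem (0 : N →ₗ[κ] κ) hN 1
  refine ⟨L, fun p hp => by simpa using LinearMap.congr_fun h1 ⟨p, hp⟩, funext fun w => ?_⟩
  cases w with
  | nil => rw [one_nil]; exact h2
  | cons a w =>
    have h3 : (fun γ => (X : Wd κ) (a :: w ++ [γ])) = 0 := by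
      funext γ
      cases w <;> rfl
    show L (fun γ => (X : Wd κ) (a :: w ++ [γ])) = pd a 1 w
    rw [h3, map_zero, pd_one]; rfl

theorem rd_X_pow {L : (ℝ → κ) →ₗ[κ] κ} (hX : rd L (X : Wd κ) = 1) (i : ℕ) :
    rd L ((X : Wd κ) ^ (i + 1)) = (i + 1 : κ) • X ^ i := by
  induction i with
  | zero => simp [hX]
  | succ i ih =>
    rw [pow_succ, rd_mul, ih, hX, smul_mul_assoc, ← pow_succ, mul_one]
    push_cast
    module

theorem iterate_rd_X_mul {L : (ℝ → κ) →ₗ[κ] κ} (hX : rd L (X : Wd κ) = 1) (q : Wd κ) (i : ℕ) :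
    (rd L)^[i + 1] (X * q) = (i + 1 : κ) • (rd L)^[i] q + X * (rd L)^[i + 1] q := by
  induction i with
  | zero => simp [rd_mul, hX]
  | succ i ih =>
    rw [Function.iterate_succ_apply', ih, map_add, map_smul, rd_mul, hX, one_mul,
      ← Function.iterate_succ_apply' (rd L), ← Function.iterate_succ_apply' (rd L)]
    push_cast
    module

variable [CharZero κ]

theorem exists_rd_mem {L : (ℝ → κ) →ₗ[κ] κ} (hX : rd L (X : Wd κ) = 1) (f : Wd κ) (M : ℕ) :
    ∃ a, rd L (f + X * a) ∈ O M := by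
  have key : ∃ a, ∃ c : κ,
      rd L (f + X * a) = c • (X ^ M * (rd L)^[M + 1] f) ∧ c * M.factorial = (-1) ^ M := by
    induction M with
    | zero => exact ⟨0, 1, by simp, by simp⟩
    | succ M ih =>
      obtain ⟨a, c, h, hc⟩ := ih
      have h0 : (M + 1 : κ) ≠ 0 := by exact_mod_cast M.succ_ne_zero
      refine ⟨a - (c / (M + 1)) • (X ^ M * (rd L)^[M + 1] f), -(c / (M + 1)), ?_, ?_⟩
      · have e : f + X * (a - (c / (M + 1)) • (X ^ M * (rd L)^[M + 1] f))
          = f + X * a - (c / (M + 1)) • (X ^ (M + 1) * (rd L)^[M + 1] f) := by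
          rw [mul_sub, mul_smul_comm, pow_succ']
          ring_nf
        rw [e, map_sub, h, map_smul, rd_mul, rd_X_pow hX, smul_mul_assoc,
          ← Function.iterate_succ_apply' (rd L) (M + 1), smul_add, smul_smul, div_mul_cancel₀ _ h0]
        module
      · rw [Nat.factorial_succ, pow_succ, ← hc]
        push_cast
        field_simp
  obtain ⟨a, c, h, -⟩ := key
  refine ⟨a, h ▸ Submodule.smul_mem _ _ (O_mul (a := M) (b := 0) (by omega) ?_ (mem_O_zero _))⟩
  simpa using O_pow (X_mem_O (κ := κ)) M

theorem X_prime {m n : ℕ} {f g d : Wd κ} (h : f * g - X * d ∈ O (m + n + 1)) :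
    (∃ e, f - X * e ∈ O (m + 1)) ∨ ∃ e, g - X * e ∈ O (n + 1) := by
  obtain ⟨L, hL, hX⟩ := exists_functional (κ := κ)
  have hiter : ∀ {i k : ℕ} {f : Wd κ}, f ∈ O (k + i) → (rd L)^[i] f ∈ O k := by
    intro i
    induction i with
    | zero => exact fun h => h
    | succ i ih => exact fun h => by rw [Function.iterate_succ_apply]; exact ih (rd_mem_O hL h)
  obtain ⟨a, ha⟩ := exists_rd_mem hX f (m + n + 1)
  obtain ⟨b, hb⟩ := exists_rd_mem hX g (m + n + 1)
  set f0 := f + X * a with hf0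
  set g0 := g + X * b with hg0
  have hu : rd L (f0 * g0) ∈ O (m + n + 1) := by
    rw [rd_mul]
    exact add_mem (mul_comm g0 (rd L f0) ▸ O_mul_left g0 ha) (O_mul_left f0 hb)
  let q := d + f * b + a * g + X * a * b
  have ho : f0 * g0 - X * q ∈ O (m + n + 1) := by
    convert h using 1
    simp only [hf0, hg0, q]; ring
  have hq : ∀ k i, i + k = m + n → (rd L)^[i] q ∈ O k := by
    intro k
    induction k with
    | zero => exact fun _ _ => mem_O_zero _
    | succ k ih =>
      intro i hi
      have h0 : (i + 1 : κ) ≠ 0 := by exact_mod_cast i.succ_ne_zero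
      rw [← Submodule.smul_mem_iff _ h0]
      have h1 : X * (rd L)^[i + 1] q ∈ O (k + 1) :=
        O_mul (by omega) X_mem_O (ih (i + 1) (by omega))
      have h2 : (rd L)^[i + 1] (f0 * g0) ∈ O (k + 1) := by
        rw [Function.iterate_succ_apply]; exact hiter (O_anti (by omega) hu)
      have h3 : (rd L)^[i + 1] (f0 * g0 - X * q) ∈ O (k + 1) := hiter (O_anti (by omega) ho)
      have h4 : (rd L)^[i + 1] (X * q) ∈ O (k + 1) := by
        have h5 := sub_mem h2 h3
        rwa [← Module.End.coe_pow, ← map_sub, sub_sub_cancel, Module.End.coe_pow] at h5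
      rw [iterate_rd_X_mul hX] at h4
      simpa using sub_mem h4 h1
  have h1 : f0 * g0 ∈ O (m + n + 1) := by
    have h2 : X * q ∈ O (m + n + 1) := O_mul (by omega) X_mem_O (hq (m + n) 0 (by omega))
    simpa using add_mem ho h2
  by_contra! hcon
  refine mul_notMem (m := m) (n := n) (fun h2 => hcon.1 (-a) ?_) (fun h2 => hcon.2 (-b) ?_) h1
  · convert h2 using 1; rw [hf0]; ring
  · convert h2 using 1; rw [hg0]; ring

end Wd

namespace HF
open Filter Topology Wd

/-- The leading coefficient of the iterated derivative of a germ along a word of length `m`. -/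
noncomputable def hatAt (s : HF) : ℕ → List ℝ → HF →+ Kap
  | 0, [] => (lead s).toAddMonoidHom
  | 0, _ :: _ => 0
  | _ + 1, [] => 0
  | m + 1, γ :: w => (hatAt s m w).comp (dd γ).toAddMonoidHom

/-- The symbol of order `m` of a germ relative to `s`. -/
noncomputable def hat (s : HF) (m : ℕ) : HF →+ Wd Kap where
  toFun y w := hatAt s m w y
  map_zero' := funext fun w => map_zero (hatAt s m w)
  map_add' y z := funext fun w => map_add (hatAt s m w) y z

theorem hat_zero_nil (s y : HF) : hat s 0 y [] = lead s y := rfl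

theorem hat_succ_nil (s y : HF) (m : ℕ) : hat s (m + 1) y [] = 0 := rfl

theorem pd_hat_zero (s y : HF) (γ : ℝ) : pd γ (hat s 0 y) = 0 := rfl

theorem pd_hat_succ (s y : HF) (m : ℕ) (γ : ℝ) : pd γ (hat s (m + 1) y) = hat s m (dd γ y) := rfl

theorem hat_mem_O (s y : HF) (m : ℕ) : hat s m y ∈ O m := by
  induction m generalizing y with
  | zero => exact mem_O_zero _
  | succ m ih => exact ⟨rfl, Eventually.of_forall fun γ => ih _⟩

theorem add_succ_nsmul (a : Deg) (m : ℕ) : a + (m + 1) • (1 : Deg) = a + m • (1 : Deg) + 1 := by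
  rw [succ_nsmul, add_assoc]

theorem hat_mem_iff {a : Deg} {s : HF} (hs : E a s) {m : ℕ} {y : HF}
    (hy : y ∈ V (a + m • (1 : Deg))) : hat s m y ∈ O (m + 1) ↔ y ∈ I (a + m • (1 : Deg)) := by
  induction m generalizing y with
  | zero =>
    rw [zero_nsmul, add_zero] at *
    rw [mem_O_one, hat_zero_nil, lead_eq_zero_iff hs hy]
  | succ m ih =>
    rw [add_succ_nsmul] at *
    have h1 := eventually_dd_mem hy
    constructor
    · rintro ⟨-, h⟩
      refine mem_I_of_eventually (Deg.lt_add_one _) hy.1 ?_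
      filter_upwards [h, h1] with γ h2 h3
      exact (ih h3).1 h2
    · intro h
      refine ⟨rfl, ?_⟩
      filter_upwards [eventually_dd_mem h, h1] with γ h2 h3
      exact (ih h3).2 h2

theorem dd_mul_mem_I {a b : Deg} (ha : Deg.IsLim a) (hb : Deg.IsLim b) {n : ℕ} {y c : HF}
    (hy : y ∈ I a) (hc : c ∈ V (b + n • (1 : Deg))) : y * c ∈ I (a + b) := by
  rcases (Deg.nonneg a).eq_or_lt with rfl | h0
  · exact I_mono (Deg.nonneg _) (I_zero_mul hy hc.1)
  · obtain ⟨a', h1, h2⟩ := exists_mem_V_of_mem_I h0 hy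
    refine V_le_I ?_ (V_mul h2 hc)
    rw [← add_assoc]
    exact Deg.IsLim.add_nsmul_lt (ha.add hb) (by gcongr) n

/-- Approximate multiplicativity of symbols of total order `k`. -/
def HatMul (k : ℕ) : Prop := ∀ {a b : Deg} {s u : HF}, Deg.IsLim a → Deg.IsLim b → E a s → E b u →
  ∀ {m n : ℕ}, m + n = k → ∀ {y z : HF}, y ∈ V (a + m • (1 : Deg)) → z ∈ V (b + n • (1 : Deg)) →
    hat (s * u) k (y * z) - hat s m y * hat u n z ∈ O (k + 1)

theorem hatMul_half {k : ℕ} (ih : HatMul k) {a b : Deg} {s u : HF} (ha : Deg.IsLim a)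
    (hb : Deg.IsLim b) (hs : E a s) (hu : E b u) {m n : ℕ} (hmn : m + n = k + 1) {y z : HF}
    (hy : y ∈ V (a + m • (1 : Deg))) (hz : z ∈ V (b + n • (1 : Deg))) :
    ∀ᶠ γ in 𝓝[<] (0 : ℝ),
      hat (s * u) k (dd γ y * z) - pd γ (hat s m y) * hat u n z ∈ O (k + 1) := by
  filter_upwards [eventually_dd_mem hy] with γ h
  cases m with
  | zero =>
    rw [pd_hat_zero, zero_mul, sub_zero]
    rw [zero_nsmul, add_zero] at h
    have h1 : dd γ y * z ∈ I (a + b + k • (1 : Deg)) :=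
      I_mono (le_add_of_nonneg_right (Deg.nonneg _)) (dd_mul_mem_I ha hb h hz)
    exact (hat_mem_iff (hs.mul hu) (I_le_V _ h1)).2 h1
  | succ m =>
    rw [pd_hat_succ]
    rw [add_succ_nsmul] at h
    exact ih ha hb hs hu (by omega) h hz

theorem hatMul (k : ℕ) : HatMul k := by
  induction k with
  | zero =>
    intro a b s u ha hb hs hu m n hmn y z hy hz
    obtain ⟨rfl, rfl⟩ : m = 0 ∧ n = 0 := by omega
    rw [zero_nsmul, add_zero] at hy hz
    rw [mem_O_one, Wd.sub_apply, mul_nil, hat_zero_nil, hat_zero_nil, hat_zero_nil,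
      lead_mul hs hu hy hz, sub_self]
  | succ k ih =>
    intro a b s u ha hb hs hu m n hmn y z hy hz
    refine ⟨?_, ?_⟩
    · rw [Wd.sub_apply, mul_nil, hat_succ_nil, zero_sub, neg_eq_zero, mul_eq_zero]
      rcases Nat.eq_zero_or_pos m with rfl | hm
      · obtain rfl : n = k + 1 := by omega
        exact Or.inr rfl
      · obtain ⟨m, rfl⟩ := Nat.exists_eq_succ_of_ne_zero hm.ne'
        exact Or.inl rfl
    · have e : a + m • (1 : Deg) + (b + n • (1 : Deg)) = a + b + k • (1 : Deg) + 1 := by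
        rw [← add_succ_nsmul, ← hmn, add_nsmul]; abel
      obtain ⟨N, hN, h⟩ := eventually_dd_mul hy hz
        (by rw [e]; exact (Deg.nonneg _).trans_lt (Deg.lt_add_one _))
      rw [e, Deg.lt_add_one_iff] at hN
      filter_upwards [h, hatMul_half ih ha hb hs hu hmn hy hz,
        hatMul_half ih hb ha hu hs (by omega : n + m = k + 1) hz hy] with γ h1 h2 h3
      have h4 := (hat_mem_iff (hs.mul hu) (I_le_V _ (I_mono hN h1))).2 (I_mono hN h1)
      rw [map_sub, pd_hat_succ, pd_mul]
      have e2 : hat (s * u) k (dd γ (y * z)) - (pd γ (hat s m y) * hat u n z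
          + hat s m y * pd γ (hat u n z))
          = hat (s * u) k (dd γ (y * z) - dd γ y * z - y * dd γ z)
            + (hat (s * u) k (dd γ y * z) - pd γ (hat s m y) * hat u n z)
            + (hat (u * s) k (dd γ z * y) - pd γ (hat u n z) * hat s m y) := by
        rw [map_sub, map_sub, mul_comm u s, mul_comm (dd γ z) y]; ring
      rw [e2]
      exact add_mem (add_mem h4 h2) h3

/-- The coefficients of the series `1 + ∑ t ^ (-1 / n)`. -/
def IsSer (x : HF) : Prop :=
  ∀ q : ℝ, x.coeff q = if q = 0 ∨ ∃ n : ℕ, q = -1 / (n + 1) then 1 else 0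

theorem t_mem_G_one (δ : ℝ) : t δ ∈ G 1 := by
  have h : (1 : HF) ∈ P 0 := by
    refine mem_P.2 ⟨one_mem_N0, fun γ hγ => ?_⟩
    have : tr γ (1 : HF) = 0 := by
      refine SI.restr_eq_zero (s := {0}) (fun q hq => ?_) fun q hq => ?_
      · rw [← t_zero, t, HahnSeries.coeff_single_of_ne (by simpa using hq)]
      · rw [Set.mem_singleton_iff.1 hq]; simpa using hγ
    rw [this]; exact zero_mem _
  simpa using t_mul_mem_G_of_P Deg.zero_lt_one δ h

theorem mem_G_one_of_finite {y : HF} (h : y.support.Finite) : y ∈ G 1 := by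
  have e : y = ∑ q ∈ h.toFinset, y.coeff q • t q := by
    ext p
    rw [HahnSeries.coeff_sum]
    simp only [HahnSeries.coeff_smul, t, HahnSeries.coeff_single, smul_eq_mul, mul_ite, mul_one,
      mul_zero]
    rw [Finset.sum_ite_eq]
    split_ifs with h1
    · rfl
    · simpa using h1
  rw [e]
  exact Submodule.sum_mem _ fun q _ => Submodule.smul_mem _ _ (t_mem_G_one q)

theorem IsSer.mem_P {x : HF} (hx : IsSer x) : x ∈ P 1 := by
  refine HF.mem_P.2 ⟨fun q hq => ?_, fun γ hγ => mem_G_one_of_finite ?_⟩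
  · have hq : 0 < q := by simpa using hq
    rw [hx, if_neg]
    rintro (rfl | ⟨n, rfl⟩)
    · exact lt_irrefl _ hq
    · have : (-1 : ℝ) / (n + 1) < 0 := div_neg_of_neg_of_pos (by norm_num) (by positivity)
      linarith
  · obtain ⟨N, hN⟩ := exists_nat_gt (1 / -γ)
    refine ((Finset.range N).image fun n : ℕ => (-1 : ℝ) / (n + 1)).finite_toSet.subset ?_
    intro q hq
    have h1 : (tr γ x).coeff q ≠ 0 := hq
    rw [restr_coeff, hx] at h1
    have h2 : q ≤ γ := by by_contra h; simp [h] at h1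
    have h3 : q = 0 ∨ ∃ n : ℕ, q = -1 / (n + 1) := by by_contra h; simp [h] at h1
    rcases h3 with rfl | ⟨n, rfl⟩
    · linarith
    · have hn : (0 : ℝ) < n + 1 := by positivity
      have h4 : (n : ℝ) < N := by
        have h5 : -γ ≤ 1 / (n + 1) := by rw [neg_div] at h2; linarith
        have h6 : (n : ℝ) + 1 ≤ 1 / -γ := by
          rw [le_div_iff₀ (by linarith)]
          rw [le_div_iff₀ hn] at h5
          linarith
        linarith
      simpa using ⟨n, by exact_mod_cast h4, rfl⟩

theorem coeff_dd_zero (γ : ℝ) (x : HF) : (dd γ x).coeff 0 = x.coeff γ := by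
  rw [dd_apply, t_mul_coeff, restr_coeff, if_pos (by simp)]
  simp

theorem IsSer.notMem_I {x : HF} (hx : IsSer x) : x ∉ I 1 := fun h => by
  have h1 : x ∈ V 0 := by rwa [V, zero_add]
  obtain ⟨n, hn⟩ := (tendsto_neg_inv.eventually (eventually_dd_mem h1)).exists
  obtain ⟨η, hη, h2⟩ := exists_SI_of_mem_I_zero hn
  have h3 := h2 0 (by simpa using hη)
  rw [coeff_dd_zero, hx, if_pos (Or.inr ⟨n, rfl⟩)] at h3
  exact one_ne_zero h3

theorem IsSer.hat_sub_mem {x : HF} (hx : IsSer x) : hat 1 1 x - X ∈ O 2 := by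
  refine ⟨?_, ?_⟩
  · rw [Wd.sub_apply, hat_succ_nil, X_nil, sub_zero]
  · have h0 : x ∈ V 1 := P_le_V 1 hx.mem_P
    filter_upwards [eventually_dd_mem h0, self_mem_nhdsWithin] with γ h hγ
    have hγ : γ < 0 := hγ
    rw [map_sub, pd_hat_succ, mem_O_one, Wd.sub_apply, hat_zero_nil]
    have h1 : dd γ x ∈ V 0 := by rwa [V, zero_add]
    have h2 := sub_coeff_mem_I_zero h1
    rw [← lead_eq_zero_iff E_one (I_le_V _ h2), map_sub, map_smul, lead_one_one, coeff_dd_zero, hx,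
      sub_eq_zero] at h2
    by_cases hn : ∃ n : ℕ, γ = -1 / (n + 1)
    · rw [pd_X_of_exists hn, one_nil, h2, if_pos (Or.inr hn), one_smul, sub_self]
    · rw [pd_X_of_not hn, h2, if_neg, zero_smul, Wd.zero_apply, sub_self]
      rintro (rfl | h3)
      · exact lt_irrefl _ hγ
      · exact hn h3

end HF

namespace HF
open Filter Topology Wd

/-- The symbols of order `r` over `s` that are realized by germs of degree at most `a + r`. -/
noncomputable def Sym (a : Deg) (s : HF) (r : ℕ) : AddSubgroup (Wd Kap) where
  carrier := {e | ∃ y ∈ V (a + r • (1 : Deg)), hat s r y - e ∈ O (r + 1)}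
  zero_mem' := ⟨0, zero_mem _, by rw [map_zero, sub_zero]; exact zero_mem _⟩
  add_mem' := by
    rintro e f ⟨y, hy, h⟩ ⟨z, hz, h'⟩
    refine ⟨y + z, add_mem hy hz, ?_⟩
    rw [map_add, add_sub_add_comm]
    exact add_mem h h'
  neg_mem' := by
    rintro e ⟨y, hy, h⟩
    refine ⟨-y, neg_mem hy, ?_⟩
    rw [map_neg, neg_sub_neg, ← neg_sub]
    exact neg_mem h

theorem mem_Sym_of_mem_O (a : Deg) (s : HF) {r : ℕ} {e : Wd Kap} (h : e ∈ O (r + 1)) :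
    e ∈ Sym a s r :=
  ⟨0, zero_mem _, by rw [map_zero, zero_sub]; exact neg_mem h⟩

theorem mem_Sym_of_nsmul {a : Deg} {s : HF} {r j : ℕ} (hj : 0 < j) {e : Wd Kap}
    (h : j • e ∈ Sym a s r) : e ∈ Sym a s r := by
  obtain ⟨y, hy, h⟩ := h
  refine ⟨(j : ℝ)⁻¹ • y, Submodule.smul_mem _ _ hy, ?_⟩
  have hj' : (j : ℝ) ≠ 0 := by exact_mod_cast hj.ne'
  have h1 : j • ((j : ℝ)⁻¹ • y) = y := by
    rw [← Nat.cast_smul_eq_nsmul ℝ, smul_smul, mul_inv_cancel₀ hj', one_smul]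
  have hk : (j : Kap) ≠ 0 := by exact_mod_cast hj.ne'
  rw [← Submodule.smul_mem_iff _ hk, Nat.cast_smul_eq_nsmul, smul_sub, ← map_nsmul, h1]
  exact h

theorem eventually_pd_mem_Sym {a : Deg} {s : HF} {r : ℕ} {e : Wd Kap} (h : e ∈ Sym a s (r + 1)) :
    ∀ᶠ γ in 𝓝[<] (0 : ℝ), pd γ e ∈ Sym a s r := by
  obtain ⟨y, hy, -, h⟩ := h
  rw [add_succ_nsmul] at hy
  filter_upwards [h, eventually_dd_mem hy] with γ h1 h2
  rw [map_sub, pd_hat_succ] at h1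
  exact ⟨_, h2, h1⟩

theorem eventually_pd_seq_mem_Sym {a : Deg} {s : HF} {r : ℕ} {e : Wd Kap}
    (h : e ∈ Sym a s (r + 1)) : ∀ᶠ n : ℕ in atTop, pd (-1 / ((n : ℝ) + 1)) e ∈ Sym a s r :=
  tendsto_neg_inv.eventually (eventually_pd_mem_Sym h)

theorem hat_ser_mul {a : Deg} {s x : HF} (ha : Deg.IsLim a) (hs : E a s) (hx : IsSer x)
    {r : ℕ} {y : HF} (hy : y ∈ V (a + r • (1 : Deg))) :
    x * y ∈ V (a + (r + 1) • (1 : Deg)) ∧ hat s (r + 1) (x * y) - X * hat s r y ∈ O (r + 2) := by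
  have hx1 : x ∈ V (0 + 1 • (1 : Deg)) := by
    rw [one_nsmul, zero_add]; exact P_le_V 1 hx.mem_P
  have h0 := V_mul hx1 hy
  refine ⟨by convert h0 using 2; rw [succ_nsmul, zero_add, one_nsmul]; abel, ?_⟩
  have h1 := hatMul (r + 1) Deg.IsLim.zero ha E_one hs (by omega : 1 + r = r + 1) hx1 hy
  rw [one_mul] at h1
  have h2 := O_mul (by omega : r + 2 ≤ 2 + r) hx.hat_sub_mem (hat_mem_O s y r)
  have h3 := add_mem h1 h2
  convert h3 using 1
  ring

theorem X_mul_mem_Sym {a : Deg} {s x : HF} (ha : Deg.IsLim a) (hs : E a s) (hx : IsSer x)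
    {r : ℕ} {e : Wd Kap} (h : e ∈ Sym a s r) : X * e ∈ Sym a s (r + 1) := by
  obtain ⟨y, hy, h⟩ := h
  obtain ⟨h1, h2⟩ := hat_ser_mul ha hs hx hy
  refine ⟨x * y, h1, ?_⟩
  have h3 := add_mem h2 (O_mul (by omega : r + 2 ≤ 1 + (r + 1)) X_mem_O h)
  convert h3 using 1
  ring

theorem mem_Sym_of_eventually {a : Deg} {s x : HF} (ha : Deg.IsLim a) (hs : E a s) (hx : IsSer x)
    (r : ℕ) {j : ℕ} (hj : 0 < j) {e : Wd Kap}
    (h : ∀ᶠ n : ℕ in atTop, j • e + X * pd (-1 / ((n : ℝ) + 1)) e ∈ Sym a s r) :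
    e ∈ Sym a s r := by
  induction r generalizing j e with
  | zero =>
    obtain ⟨n, hn⟩ := h.exists
    refine mem_Sym_of_nsmul hj ?_
    have := sub_mem hn (mem_Sym_of_mem_O a s (O_mul (by omega : 0 + 1 ≤ 1 + 0) X_mem_O
      (mem_O_zero (pd (-1 / ((n : ℝ) + 1)) e))))
    rwa [add_sub_cancel_right] at this
  | succ r ih =>
    have hpd (n : ℕ) (w : Wd Kap) : pd (-1 / ((n : ℝ) + 1)) (X * w)
        = w + X * pd (-1 / ((n : ℝ) + 1)) w := by
      rw [pd_mul, pd_X_of_exists ⟨n, rfl⟩, one_mul]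
    obtain ⟨N, hN⟩ := eventually_atTop.1 h
    have hsub : ∀ k ≥ N, ∀ n ≥ N,
        pd (-1 / ((k : ℝ) + 1)) e - pd (-1 / ((n : ℝ) + 1)) e ∈ Sym a s r := by
      intro k hk n hn
      refine ih one_pos ?_
      have h1 := sub_mem (hN k hk) (hN n hn)
      rw [add_sub_add_left_eq_sub, ← mul_sub] at h1
      filter_upwards [eventually_pd_seq_mem_Sym h1] with l hl
      rwa [one_nsmul, ← hpd]
    have hd : pd (-1 / ((N : ℝ) + 1)) e ∈ Sym a s r := by
      refine ih j.succ_pos ?_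
      filter_upwards [eventually_pd_seq_mem_Sym (hN N le_rfl), eventually_ge_atTop N] with k h1 hk
      rw [map_add, map_nsmul, hpd] at h1
      have h2 := sub_mem h1 (nsmul_mem (hsub k hk N le_rfl) j)
      convert h2 using 1
      rw [succ_nsmul, smul_sub]; abel
    refine mem_Sym_of_nsmul hj ?_
    have := sub_mem (hN N le_rfl) (X_mul_mem_Sym ha hs hx hd)
    rwa [add_sub_cancel_right] at this

theorem mem_Sym_of_X_mul_mem {a : Deg} {s x : HF} (ha : Deg.IsLim a) (hs : E a s) (hx : IsSer x)
    {r : ℕ} {e : Wd Kap} (h : X * e ∈ Sym a s (r + 1)) : e ∈ Sym a s r := by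
  refine mem_Sym_of_eventually ha hs hx r one_pos ?_
  filter_upwards [eventually_pd_seq_mem_Sym h] with n hn
  rw [one_nsmul]; rwa [pd_mul, pd_X_of_exists ⟨n, rfl⟩, one_mul] at hn

theorem exists_E_of_E_add {a : Deg} {b : HF} (m : ℕ) (h : E (a + m • (1 : Deg)) b) :
    ∃ s, E a s := by
  induction m generalizing b with
  | zero => exact ⟨b, by rwa [zero_nsmul, add_zero] at h⟩
  | succ m ih =>
    rw [add_succ_nsmul] at h
    obtain ⟨δ, h1, h2⟩ := ((frequently_dd h (Deg.lt_add_one _)).and_eventually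
      (eventually_dd_mem h.1)).exists
    exact ih ⟨h2, h1⟩

theorem exists_P_of_hat_sub_mem {a α : Deg} {s x b : HF} (ha : Deg.IsLim a) (hs : E a s)
    (hx : IsSer x) {m : ℕ} (hα : α = a + m • (1 : Deg)) (hb : E α b) {e : Wd Kap}
    (he : hat s m b - X * e ∈ O (m + 1)) : ∃ α', ∃ y ∈ P α', α' + 1 = α ∧ b - x * y ∈ I α := by
  subst hα
  cases m with
  | zero =>
    refine absurd ((hat_mem_iff hs hb.1).1 ?_) hb.2
    have := add_mem he (O_mul (by omega : 0 + 1 ≤ 1 + 0) X_mem_O (mem_O_zero e))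
    rwa [sub_add_cancel] at this
  | succ r =>
    obtain ⟨y, hy, h⟩ := mem_Sym_of_X_mul_mem ha hs hx (r := r) (e := e) ⟨b, hb.1, he⟩
    obtain ⟨h1, h2⟩ := hat_ser_mul ha hs hx hy
    obtain ⟨h0, η, hη, h3⟩ := mem_V_iff.1 hy
    refine ⟨a + r • (1 : Deg), _, h3, (add_succ_nsmul _ _).symm, ?_⟩
    have h4 : b - x * y ∈ I (a + (r + 1) • (1 : Deg)) := by
      rw [← hat_mem_iff hs (sub_mem hb.1 h1), map_sub]
      have h5 := sub_mem (sub_mem he h2)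
        (O_mul (by omega : r + 1 + 1 ≤ 1 + (r + 1)) X_mem_O h)
      convert h5 using 1
      ring
    have h5 : tr (-η) y ∈ I 0 := mem_I_of_SI (by linarith) (SI_restr _ _) 0
    have h6 := I_mono (Deg.nonneg (a + (r + 1) • (1 : Deg))) (I_zero_mul h5 (mem_P.1 hx.mem_P).1)
    have h7 := add_mem h4 h6
    convert h7 using 1
    rw [restr_Ioi]; ring

/-- Local primality of the series. -/
theorem exists_P_of_sub_mul_mem {x b c d : HF} {α β θ : Deg} (hx : IsSer x) (hb : E α b)
    (hc : E β c) (hd : d ∈ V θ) (hθ : α + β = θ + 1) (h : x * d - b * c ∈ I (α + β)) :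
    (∃ α', ∃ y ∈ P α', α' + 1 = α ∧ b - x * y ∈ I α) ∨
      ∃ β', ∃ y ∈ P β', β' + 1 = β ∧ c - x * y ∈ I β := by
  obtain ⟨a, ha, m, rfl⟩ := Deg.exists_isLim_add α
  obtain ⟨b', hb', n, rfl⟩ := Deg.exists_isLim_add β
  obtain ⟨s, hs⟩ := exists_E_of_E_add m hb
  obtain ⟨u, hu⟩ := exists_E_of_E_add n hc
  have hlim := ha.add hb'
  have e1 : a + m • (1 : Deg) + (b' + n • (1 : Deg)) = a + b' + (m + n) • (1 : Deg) := by
    rw [add_nsmul]; abel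
  rw [e1] at hθ h
  obtain ⟨p, hp⟩ : ∃ p, m + n = p + 1 := by
    refine Nat.exists_eq_succ_of_ne_zero fun h0 => ?_
    rw [h0, zero_nsmul, add_zero] at hθ
    have := hlim.add_nsmul_lt (hθ ▸ Deg.lt_add_one θ) 1
    rw [one_nsmul, hθ] at this
    exact this.false
  have hθ' : θ = a + b' + p • (1 : Deg) := by
    rw [hp, add_succ_nsmul] at hθ; exact (add_right_cancel hθ).symm
  rw [hθ'] at hd
  obtain ⟨h1, h2⟩ := hat_ser_mul hlim (hs.mul hu) hx hd
  have h3 := hatMul (m + n) ha hb' hs hu rfl hb.1 hc.1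
  rw [← hp] at h1 h2
  have h4 := (hat_mem_iff (hs.mul hu) (I_le_V _ h)).2 h
  have h5 : hat s m b * hat u n c - X * hat (s * u) p d ∈ O (m + n + 1) := by
    have h2' : hat (s * u) (m + n) (x * d) - X * hat (s * u) p d ∈ O (m + n + 1) := by
      rw [hp] at h2 ⊢; exact h2
    have := sub_mem (sub_mem h2' h3) h4
    rw [map_sub] at this
    convert this using 1
    ring
  rcases X_prime h5 with ⟨e, he⟩ | ⟨e, he⟩
  · exact Or.inl (exists_P_of_hat_sub_mem ha hs hx rfl hb he)
  · exact Or.inr (exists_P_of_hat_sub_mem hb' hu hx rfl hc he)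

end HF

namespace HF
open Filter Topology

theorem dd_mem_I_of_mem_G {α : Deg} {b : HF} (δ : ℝ) (hb : b ∈ G α) : dd δ b ∈ I α :=
  mem_I_of_mem_G (dd_mem_N0 δ b) (t_mul_mem_G _ (tr_mem_G δ hb))

theorem dd_t_mul (δ ε : ℝ) (b : HF) : dd δ (t ε * b) = dd (δ - ε) b := by
  rw [dd_apply, restr_t_mul, t_mul_t_mul, dd_apply, neg_sub, neg_add_eq_sub]
  congr 3; ext q; simp [le_sub_iff_add_le]

theorem dd_zero_of_mem_N0 {b : HF} (hb : b ∈ N0) : dd 0 b = b := by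
  rw [dd_apply, neg_zero, t_zero, one_mul]; exact SI.restr_eq hb le_rfl

theorem dd_mem_I_of_pos {δ : ℝ} (hδ : 0 < δ) {b : HF} (hb : b ∈ N0) (α : Deg) : dd δ b ∈ I α := by
  refine mem_I_of_SI (neg_neg_of_pos hδ) (SI_t_mul _ ((SI.restr hb).mono Set.inter_subset_right)
    fun q hq => ?_) α
  simpa using hq

theorem dd_mem_I_of_neg {α : Deg} {δ : ℝ} (hδ : δ < 0) {b : HF} (hb : b ∈ P α) : dd δ b ∈ I α :=
  mem_I_of_mem_G (dd_mem_N0 δ b) (t_mul_mem_G _ ((mem_P.1 hb).2 δ hδ))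

theorem dd_t_mul_mem_I {α : Deg} {δ ε : ℝ} (h : δ ≠ ε) {b : HF} (hb : b ∈ P α) :
    dd δ (t ε * b) ∈ I α := by
  rw [dd_t_mul]
  rcases h.lt_or_gt with h | h
  · exact dd_mem_I_of_neg (by linarith) hb
  · exact dd_mem_I_of_pos (by linarith) (mem_P.1 hb).1 α

theorem dd_t_mul_self {δ : ℝ} {b : HF} (hb : b ∈ N0) : dd δ (t δ * b) = b := by
  rw [dd_t_mul, sub_self, dd_zero_of_mem_N0 hb]

/-- The points at which the germ of `b` has degree at least `α`. -/
def Top (α : Deg) (b : HF) : Set ℝ := {δ | dd δ b ∉ I α}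

theorem mem_Top {α : Deg} {b : HF} {δ : ℝ} : δ ∈ Top α b ↔ dd δ b ∉ I α := Iff.rfl

theorem Top_finite {α : Deg} {b : HF} (hb : b ∈ G (α + 1)) : (Top α b).Finite := by
  let K : Submodule ℝ HF :=
    { carrier := {y | (Top α y).Finite}
      add_mem' := by
        intro y z hy hz
        refine (Set.Finite.union hy hz).subset fun δ hδ => ?_
        by_contra h
        rw [Set.mem_union, not_or, mem_Top, mem_Top, not_not, not_not] at h
        exact hδ (by rw [map_add]; exact add_mem h.1 h.2)
      zero_mem' := by
        refine Set.finite_empty.subset fun δ hδ => hδ ?_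
        rw [map_zero]; exact zero_mem _
      smul_mem' := by
        intro r y hy
        refine Set.Finite.subset hy fun δ hδ h => hδ ?_
        rw [map_smul]; exact Submodule.smul_mem _ _ h }
  have : G (α + 1) ≤ K := G_induction fun β hβ ε c hc =>
    (Set.finite_singleton ε).subset fun δ hδ => by
      by_contra h
      exact hδ (dd_t_mul_mem_I h (P_mono (Deg.lt_add_one_iff.1 hβ) hc))
  exact this hb

theorem mem_G_of_Top_eq_empty {α : Deg} {b : HF} (h0 : b ∈ N0) (h : Top α b = ∅) : b ∈ G α :=
  mem_G_of_forall_dd h0 fun δ => by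
    by_contra h1
    exact (h ▸ (show δ ∈ Top α b from h1) : δ ∈ (∅ : Set ℝ))

theorem le_zero_of_mem_Top {α : Deg} {b : HF} (h0 : b ∈ N0) {δ : ℝ} (h : δ ∈ Top α b) : δ ≤ 0 := by
  by_contra hδ
  exact h (dd_mem_I_of_pos (not_le.1 hδ) h0 α)

theorem Top_sub_subset {α : Deg} {b v : HF} {δ : ℝ} (hv : v ∈ P α) (h : dd δ b - v ∈ I α) :
    Top α (b - t δ * v) ⊆ Top α b \ {δ} := by
  intro ε hε
  have hne : ε ≠ δ := by
    rintro rfl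
    refine hε ?_
    rwa [map_sub, dd_t_mul_self (mem_P.1 hv).1]
  refine ⟨fun h1 => hε ?_, hne⟩
  rw [map_sub]
  exact sub_mem h1 (dd_t_mul_mem_I hne hv)

theorem exists_mem_G_succ {α : Deg} {b : HF} (hb : b ∈ G α) (h : b ≠ 0) :
    ∃ β < α, b ∈ G (β + 1) := by
  let K : Submodule ℝ HF :=
    { carrier := {y | y = 0 ∨ ∃ β < α, y ∈ G (β + 1)}
      add_mem' := by
        rintro y z (rfl | ⟨β, hβ, hy⟩) (rfl | ⟨γ, hγ, hz⟩)
        · exact Or.inl (add_zero 0)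
        · exact Or.inr ⟨γ, hγ, by rwa [zero_add]⟩
        · exact Or.inr ⟨β, hβ, by rwa [add_zero]⟩
        · refine Or.inr ⟨max β γ, max_lt hβ hγ, add_mem (G_mono ?_ hy) (G_mono ?_ hz)⟩
          · gcongr; exact le_max_left _ _
          · gcongr; exact le_max_right _ _
      zero_mem' := Or.inl rfl
      smul_mem' := by
        rintro r y (rfl | ⟨β, hβ, hy⟩)
        · exact Or.inl (smul_zero r)
        · exact Or.inr ⟨β, hβ, Submodule.smul_mem _ _ hy⟩ }
  have : G α ≤ K := G_induction fun β hβ ε c hc =>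
    Or.inr ⟨β, hβ, t_mul_mem_G_of_P (Deg.lt_add_one β) ε hc⟩
  exact (this hb).resolve_left h

theorem exists_Top_nonempty {b : HF} (h0 : b ∈ N0) (h : b ≠ 0) :
    ∃ α, b ∈ G (α + 1) ∧ (Top α b).Nonempty := by
  obtain ⟨α, hα⟩ := exists_mem_G h0
  induction α using WellFoundedLT.induction with
  | ind α ih =>
  obtain ⟨β, hβ, h1⟩ := exists_mem_G_succ hα h
  rcases (Top β b).eq_empty_or_nonempty with h2 | h2
  · exact ih β hβ (mem_G_of_Top_eq_empty h0 h2)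
  · exact ⟨β, h1, h2⟩

/-- Sums of translates of elements of `P α` by exponents at most `δ`, up to lower degree. -/
noncomputable def M (α : Deg) (δ : ℝ) : Submodule ℝ HF :=
  Submodule.span ℝ {y | ∃ ε ≤ δ, ∃ c ∈ P α, y = t ε * c} ⊔ G α

theorem M_induction {α : Deg} {δ : ℝ} {K : Submodule ℝ HF}
    (h : ∀ ε ≤ δ, ∀ c ∈ P α, t ε * c ∈ K) (h' : G α ≤ K) : M α δ ≤ K := by
  refine sup_le (Submodule.span_le.2 ?_) h'
  rintro _ ⟨ε, hε, c, hc, rfl⟩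
  exact h ε hε c hc

theorem t_mul_mem_M {α : Deg} {ε δ : ℝ} (h : ε ≤ δ) {c : HF} (hc : c ∈ P α) : t ε * c ∈ M α δ :=
  Submodule.mem_sup_left (Submodule.subset_span ⟨ε, h, c, hc, rfl⟩)

theorem M_mono (α : Deg) {δ ε : ℝ} (h : δ ≤ ε) : M α δ ≤ M α ε :=
  M_induction (fun _ hε _ hc => t_mul_mem_M (hε.trans h) hc) le_sup_right

theorem mem_M {α : Deg} {b : HF} {δ : ℝ} (h0 : b ∈ N0) (hb : b ∈ G (α + 1))
    (h : ∀ ε ∈ Top α b, ε ≤ δ) : b ∈ M α δ := by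
  induction hn : (Top α b).ncard using Nat.strong_induction_on generalizing b with
  | _ n ih =>
  rcases (Top α b).eq_empty_or_nonempty with h2 | ⟨ε, hε⟩
  · exact Submodule.mem_sup_right (mem_G_of_Top_eq_empty h0 h2)
  · have h3 : dd ε b ∈ V α := dd_mem_I_of_mem_G ε hb
    obtain ⟨h4, η, hη, h5⟩ := mem_V_iff.1 h3
    set v := restr (Set.Ioi (-η)) (dd ε b) with hv
    have h6 : dd ε b - v ∈ I α := by
      rw [hv, restr_Ioi, sub_sub_cancel]
      exact mem_I_of_SI (by linarith) (SI_restr _ _) α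
    have h7 := Top_sub_subset h5 h6
    have h8 : t ε * v ∈ N0 := SI_t_mul ε (mem_P.1 h5).1 fun q hq => by
      have := le_zero_of_mem_Top h0 hε
      simp at hq ⊢; linarith
    have h9 : b - t ε * v ∈ M α δ := by
      refine ih _ ?_ (sub_mem h0 h8)
        (sub_mem hb (t_mul_mem_G_of_P (Deg.lt_add_one α) ε h5)) (fun ε' h' => h ε' (h7 h').1) rfl
      rw [← hn]
      exact (Set.ncard_le_ncard h7 ((Top_finite hb).subset Set.sdiff_subset)).trans_lt
        (Set.ncard_sdiff_singleton_lt_of_mem hε (Top_finite hb))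
    rw [← sub_add_cancel b (t ε * v)]
    exact add_mem h9 (t_mul_mem_M (h ε hε) h5)

theorem M_le_G (α : Deg) (δ : ℝ) : M α δ ≤ G (α + 1) :=
  M_induction (fun ε _ _ hc => t_mul_mem_G_of_P (Deg.lt_add_one α) ε hc)
    (G_mono (Deg.lt_add_one α).le)

theorem G_mul_P {α β : Deg} {b c : HF} (hb : b ∈ G α) (hc : c ∈ P β) : b * c ∈ G (α + β) :=
  mul_mem_G hb fun _ h _ ha => P_le_G (add_lt_add_left h β) (P_mul ha hc)

theorem G_mul_G {α β : Deg} {b c : HF} (hb : b ∈ G α) (hc : c ∈ G β) : b * c ∈ G (α + β) :=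
  mul_mem_G hb fun α' h a ha => by
    rw [mul_comm]
    refine G_mono ?_ (G_mul_P hc ha)
    rw [add_comm]; gcongr

theorem G_succ_mul {α β : Deg} {b c : HF} (hb : b ∈ G (α + 1)) (hc : c ∈ G (β + 1)) :
    b * c ∈ G (α + β + 1) :=
  mul_mem_G hb fun α' h a ha => by
    rw [mul_comm]
    refine G_mono ?_ (G_mul_P hc ha)
    have := Deg.lt_add_one_iff.1 h
    calc β + 1 + α' ≤ β + 1 + α := by gcongr
      _ = α + β + 1 := by abel

theorem dd_mul_sub_mem_of_t_mul {α β : Deg} {δ δ' ε ε' : ℝ} (hδ : δ' ≤ δ) (hε : ε' ≤ ε) {b c : HF}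
    (hb : b ∈ P α) (hc : c ∈ P β) :
    dd (δ + ε) (t δ' * b * (t ε' * c)) - dd δ (t δ' * b) * dd ε (t ε' * c) ∈ I (α + β) := by
  have e : t δ' * b * (t ε' * c) = t (δ' + ε') * (b * c) := by rw [← t_mul_t]; ring
  have hV {γ : Deg} {a : HF} (h : a ∈ P γ) (η η' : ℝ) : dd η (t η' * a) ∈ V γ :=
    dd_mem_I_of_mem_G η (t_mul_mem_G_of_P (Deg.lt_add_one γ) η' h)
  rw [e]
  by_cases h : δ' = δ ∧ ε' = ε
  · obtain ⟨rfl, rfl⟩ := h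
    rw [dd_t_mul_self (mem_P.1 (P_mul hb hc)).1, dd_t_mul_self (mem_P.1 hb).1,
      dd_t_mul_self (mem_P.1 hc).1, sub_self]
    exact zero_mem _
  · refine sub_mem (dd_t_mul_mem_I ?_ (P_mul hb hc)) ?_
    · rintro h1
      exact h ⟨by linarith, by linarith⟩
    · by_cases h1 : δ' = δ
      · exact V_mul_I (hV hb _ _) (dd_t_mul_mem_I (fun h2 => h ⟨h1, h2.symm⟩) hc)
      · exact I_mul_V (dd_t_mul_mem_I (fun h2 => h1 h2.symm) hb) (hV hc _ _)

/-- The linear map measuring the failure of `dd` to be multiplicative on products with `c`. -/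
noncomputable def ddMulSub (δ ε : ℝ) (c : HF) : HF →ₗ[ℝ] HF :=
  dd (δ + ε) ∘ₗ mulL c - mulL (dd ε c) ∘ₗ dd δ

theorem ddMulSub_apply (δ ε : ℝ) (c b : HF) :
    ddMulSub δ ε c b = dd (δ + ε) (b * c) - dd δ b * dd ε c := by
  rw [mul_comm b, mul_comm (dd δ b)]; rfl

theorem ddMulSub_mem_of_G {α β : Deg} {δ ε : ℝ} {b c : HF} (hb : b ∈ G α) (hc : c ∈ M β ε) :
    dd (δ + ε) (b * c) - dd δ b * dd ε c ∈ I (α + β) := by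
  have h1 : b * c ∈ G (α + β) := by
    have : M β ε ≤ (G (α + β)).comap (mulL b) := by
      refine M_induction (fun ε' _ a ha => ?_) fun a ha => G_mul_G hb ha
      rw [Submodule.mem_comap, mulL_apply, mul_left_comm]
      exact t_mul_mem_G _ (G_mul_P hb ha)
    exact this hc
  exact sub_mem (dd_mem_I_of_mem_G _ h1)
    (I_mul_V (dd_mem_I_of_mem_G _ hb) (dd_mem_I_of_mem_G _ (M_le_G _ _ hc)))

theorem dd_mul_sub_mem {α β : Deg} {δ ε : ℝ} {b c : HF} (hb : b ∈ M α δ) (hc : c ∈ M β ε) :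
    dd (δ + ε) (b * c) - dd δ b * dd ε c ∈ I (α + β) := by
  have : M α δ ≤ (I (α + β)).comap (ddMulSub δ ε c) := by
    refine M_induction (fun δ' hδ b hb => ?_) fun b hb => ?_
    · have : M β ε ≤ (I (β + α)).comap (ddMulSub ε δ (t δ' * b)) := by
        refine M_induction (fun ε' hε c hc => ?_) fun c hc => ?_
        · rw [Submodule.mem_comap, ddMulSub_apply]
          exact dd_mul_sub_mem_of_t_mul hε hδ hc hb
        · rw [Submodule.mem_comap, ddMulSub_apply]
          exact ddMulSub_mem_of_G hc (t_mul_mem_M hδ hb)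
      have h1 := this hc
      rw [Submodule.mem_comap, ddMulSub_apply] at h1 ⊢
      rwa [add_comm α, add_comm δ, mul_comm (t δ' * b), mul_comm (dd δ _)]
    · rw [Submodule.mem_comap, ddMulSub_apply]
      exact ddMulSub_mem_of_G hb hc
  have h := this hb
  rwa [Submodule.mem_comap, ddMulSub_apply] at h

theorem dd_mem_I_of_mem_M {α : Deg} {δ ε : ℝ} {b : HF} (hb : b ∈ M α δ) (h : δ < ε) :
    dd ε b ∈ I α := by
  have : M α δ ≤ (I α).comap (dd ε) :=
    M_induction (fun δ' hδ b hb => dd_t_mul_mem_I (by linarith) hb)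
      fun b hb => dd_mem_I_of_mem_G _ hb
  exact this hb

theorem dd_mul_mem_of_lt {α β : Deg} {δ ε τ : ℝ} {b c : HF} (hb : b ∈ M α δ) (hc : c ∈ M β ε)
    (hτ : δ + ε < τ) : dd τ (b * c) ∈ I (α + β) := by
  have h1 := dd_mul_sub_mem (M_mono α (by linarith : δ ≤ τ - ε) hb) hc
  have h2 : dd (τ - ε) b ∈ I α := dd_mem_I_of_mem_M hb (by linarith)
  have h3 := add_mem h1 (I_mul_V h2 (dd_mem_I_of_mem_G ε (M_le_G _ _ hc)))
  rwa [sub_add_cancel, sub_add_cancel] at h3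

end HF

namespace HF

/-- `b` has degree `α`, attained last at the exponent `δ`. -/
structure IsTop (α : Deg) (δ : ℝ) (b : HF) : Prop where
  mem_N0 : b ∈ N0
  mem_M : b ∈ M α δ
  notMem : dd δ b ∉ I α

theorem exists_IsTop_of_Top_nonempty {α : Deg} {b : HF} (h0 : b ∈ N0) (hb : b ∈ G (α + 1))
    (h : (Top α b).Nonempty) : ∃ δ, IsTop α δ b := by
  obtain ⟨δ, hδ, hmax⟩ := Set.exists_max_image _ id (Top_finite hb) h
  exact ⟨δ, h0, mem_M h0 hb hmax, hδ⟩

theorem exists_IsTop {b : HF} (h0 : b ∈ N0) (hb : b ≠ 0) : ∃ α δ, IsTop α δ b := by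
  obtain ⟨α, h1, h2⟩ := exists_Top_nonempty h0 hb
  exact ⟨α, exists_IsTop_of_Top_nonempty h0 h1 h2⟩

theorem IsTop.mem_G {α : Deg} {δ : ℝ} {b : HF} (h : IsTop α δ b) : b ∈ G (α + 1) :=
  M_le_G α δ h.mem_M

theorem IsTop.E {α : Deg} {δ : ℝ} {b : HF} (h : IsTop α δ b) : E α (dd δ b) :=
  ⟨dd_mem_I_of_mem_G δ h.mem_G, h.notMem⟩

theorem IsTop.le {α β : Deg} {δ ε : ℝ} {b : HF} (h : IsTop α δ b) (h' : IsTop β ε b) : β ≤ α := by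
  by_contra hlt
  exact h'.notMem (dd_mem_I_of_mem_G ε (G_mono (Deg.add_one_le_iff.2 (not_le.1 hlt)) h.mem_G))

theorem IsTop.unique {α β : Deg} {δ ε : ℝ} {b : HF} (h : IsTop α δ b) (h' : IsTop β ε b) :
    α = β ∧ δ = ε := by
  obtain rfl : α = β := le_antisymm (h'.le h) (h.le h')
  refine ⟨rfl, le_antisymm ?_ ?_⟩ <;> by_contra hlt
  · exact h.notMem (dd_mem_I_of_mem_M h'.mem_M (not_le.1 hlt))
  · exact h'.notMem (dd_mem_I_of_mem_M h.mem_M (not_le.1 hlt))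

theorem IsTop.mul {α β : Deg} {δ ε : ℝ} {b c : HF} (hb : IsTop α δ b) (hc : IsTop β ε c) :
    IsTop (α + β) (δ + ε) (b * c) where
  mem_N0 := N0_mul hb.mem_N0 hc.mem_N0
  mem_M := HF.mem_M (N0_mul hb.mem_N0 hc.mem_N0) (G_succ_mul hb.mem_G hc.mem_G) fun τ hτ => by
    by_contra hlt
    exact hτ (dd_mul_mem_of_lt hb.mem_M hc.mem_M (not_le.1 hlt))
  notMem h := by
    have h1 := sub_mem h (dd_mul_sub_mem hb.mem_M hc.mem_M)
    rw [sub_sub_cancel] at h1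
    exact (hb.E.mul hc.E).2 h1

theorem IsSer.isTop {x : HF} (hx : IsSer x) : IsTop 1 0 x where
  mem_N0 := (HF.mem_P.1 hx.mem_P).1
  mem_M := by
    have := t_mul_mem_M (le_refl (0 : ℝ)) hx.mem_P
    rwa [t_zero, one_mul] at this
  notMem := by
    rw [dd_zero_of_mem_N0 (HF.mem_P.1 hx.mem_P).1]
    exact hx.notMem_I

/-- Subtracting a multiple of the series to remove the top germ of `b`. -/
theorem IsSer.exists_reduce {x b : HF} (hx : IsSer x) {α α' : Deg} {δ : ℝ} (hb : IsTop α δ b)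
    {y : HF} (hy : y ∈ P α') (hα : α' + 1 = α) (h : dd δ b - x * y ∈ I α) :
    ∃ e ∈ N0, b - x * e ∈ N0 ∧ b - x * e ∈ G (α + 1) ∧
      (Top α (b - x * e)).ncard < (Top α b).ncard := by
  have hxy : x * y ∈ P α := by
    have := P_mul hx.mem_P hy
    rwa [add_comm, hα] at this
  have e1 : x * (t δ * y) = t δ * (x * y) := mul_left_comm _ _ _
  have h0 : t δ * y ∈ N0 := SI_t_mul δ (HF.mem_P.1 hy).1 fun q hq => by
    have := le_zero_of_mem_Top hb.mem_N0 hb.notMem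
    simp at hq ⊢; linarith
  refine ⟨t δ * y, h0, sub_mem hb.mem_N0 (N0_mul (HF.mem_P.1 hx.mem_P).1 h0), ?_, ?_⟩
  · rw [e1]; exact sub_mem hb.mem_G (t_mul_mem_G_of_P (Deg.lt_add_one α) δ hxy)
  · rw [e1]
    have hfin := Top_finite hb.mem_G
    exact (Set.ncard_le_ncard (Top_sub_subset hxy h) (hfin.subset Set.sdiff_subset)).trans_lt
      (Set.ncard_sdiff_singleton_lt_of_mem hb.notMem hfin)

/-- `b` has degree at most `p.1`, attained at exactly `p.2` points. -/
def HasRank (p : Deg ×ₗ ℕ) (b : HF) : Prop :=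
  b ∈ G ((ofLex p).1 + 1) ∧ (Top (ofLex p).1 b).ncard = (ofLex p).2

theorem exists_HasRank {b : HF} (h0 : b ∈ N0) : ∃ p, HasRank p b := by
  obtain ⟨α, h⟩ := exists_mem_G h0
  exact ⟨toLex (α, (Top α b).ncard), G_mono (Deg.lt_add_one α).le h, rfl⟩

theorem exists_HasRank_lt {p : Deg ×ₗ ℕ} {b : HF} (h0 : b ∈ N0) (hb : b ≠ 0)
    (hT : Top (ofLex p).1 b = ∅) : ∃ p' < p, HasRank p' b := by
  obtain ⟨β, hβ, h1⟩ := exists_mem_G_succ (mem_G_of_Top_eq_empty h0 hT) hb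
  exact ⟨toLex (β, (Top β b).ncard), Prod.Lex.lt_iff.2 (Or.inl hβ), h1, rfl⟩

/-- The series is prime among the series with nonpositive real exponents. -/
theorem IsSer.prime {x : HF} (hx : IsSer x) {b c d : HF} (hb : b ∈ N0) (hc : c ∈ N0) (hd : d ∈ N0)
    (h : b * c = x * d) : (∃ e ∈ N0, b = x * e) ∨ ∃ e ∈ N0, c = x * e := by
  obtain ⟨p, hp⟩ := exists_HasRank hb
  obtain ⟨q, hq⟩ := exists_HasRank hc
  induction p using WellFoundedLT.induction generalizing q b c d with
  | ind p ihp =>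
  induction q using WellFoundedLT.induction generalizing c d with
  | ind q ihq =>
  by_cases hb0 : b = 0
  · exact Or.inl ⟨0, zero_mem _, by rw [hb0, mul_zero]⟩
  by_cases hc0 : c = 0
  · exact Or.inr ⟨0, zero_mem _, by rw [hc0, mul_zero]⟩
  rcases (Top (ofLex p).1 b).eq_empty_or_nonempty with hTb | hTb
  · obtain ⟨p', hlt, hp'⟩ := exists_HasRank_lt hb hb0 hTb
    exact ihp p' hlt hb hc hd h hp' q hq
  rcases (Top (ofLex q).1 c).eq_empty_or_nonempty with hTc | hTc
  · obtain ⟨q', hlt, hq'⟩ := exists_HasRank_lt hc hc0 hTc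
    exact ihq q' hlt hc hd h hq'
  have hd0 : d ≠ 0 := by
    rintro rfl
    rw [mul_zero] at h
    exact (mul_ne_zero hb0 hc0) h
  obtain ⟨δ, hδ⟩ := exists_IsTop_of_Top_nonempty hb hp.1 hTb
  obtain ⟨ε, hε⟩ := exists_IsTop_of_Top_nonempty hc hq.1 hTc
  obtain ⟨θ, ρ, hρ⟩ := exists_IsTop hd hd0
  have h1 := hδ.mul hε
  have h2 := hx.isTop.mul hρ
  rw [← h] at h2
  obtain ⟨hdeg, hpt⟩ := h1.unique h2
  have h3 := dd_mul_sub_mem hδ.mem_M hε.mem_M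
  have h4 := dd_mul_sub_mem hx.isTop.mem_M hρ.mem_M
  rw [← h, ← hpt, ← hdeg, dd_zero_of_mem_N0 hx.isTop.mem_N0] at h4
  have h5 := sub_mem h3 h4
  rw [sub_sub_sub_cancel_left] at h5
  rcases exists_P_of_sub_mul_mem hx hδ.E hε.E hρ.E.1 (by rw [hdeg, add_comm]) h5 with
    ⟨α', y, hy, hα, h6⟩ | ⟨β', y, hy, hβ, h6⟩
  · obtain ⟨e, he, h7, h8, h9⟩ := hx.exists_reduce hδ hy hα h6
    have h10 : (b - x * e) * c = x * (d - e * c) := by rw [sub_mul, h]; ring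
    have hlt : toLex ((ofLex p).1, (Top (ofLex p).1 (b - x * e)).ncard) < p :=
      Prod.Lex.lt_iff.2 (Or.inr ⟨rfl, h9.trans_eq hp.2⟩)
    rcases ihp _ hlt h7 hc (sub_mem hd (N0_mul he hc)) h10 ⟨h8, rfl⟩ q hq with ⟨f, hf, h11⟩ | h11
    · exact Or.inl ⟨f + e, add_mem hf he, by rw [mul_add, ← h11, sub_add_cancel]⟩
    · exact Or.inr h11
  · obtain ⟨e, he, h7, h8, h9⟩ := hx.exists_reduce hε hy hβ h6
    have h10 : b * (c - x * e) = x * (d - b * e) := by rw [mul_sub, h]; ring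
    have hlt : toLex ((ofLex q).1, (Top (ofLex q).1 (c - x * e)).ncard) < q :=
      Prod.Lex.lt_iff.2 (Or.inr ⟨rfl, h9.trans_eq hq.2⟩)
    rcases ihq _ hlt h7 (sub_mem hd (N0_mul hb he)) h10 ⟨h8, rfl⟩ with h11 | ⟨f, hf, h11⟩
    · exact Or.inl h11
    · exact Or.inr ⟨f + e, add_mem hf he, by rw [mul_add, ← h11, sub_add_cancel]⟩

end HF

namespace HF

/-- The inclusion of the nonpositive rationals into the reals. -/
noncomputable def ratExp : ℚ≥0ᵒᵈ →+ ℝ where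
  toFun q := -((OrderDual.ofDual q : ℚ≥0) : ℝ)
  map_zero' := by simp
  map_add' p q := by
    rw [ofDual_add]; push_cast; ring

theorem ratExp_apply (q : ℚ≥0ᵒᵈ) : ratExp q = -((OrderDual.ofDual q : ℚ≥0) : ℝ) := rfl

theorem ratExp_injective : Function.Injective ratExp := fun p q h => by
  rw [ratExp_apply, ratExp_apply, neg_inj] at h
  exact OrderDual.ofDual.injective (by exact_mod_cast h)

theorem ratExp_le (p q : ℚ≥0ᵒᵈ) : ratExp p ≤ ratExp q ↔ p ≤ q := by
  rw [ratExp_apply, ratExp_apply, neg_le_neg_iff, NNRat.cast_le, OrderDual.ofDual_le_ofDual]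

/-- The inclusion of the series with nonpositive rational exponents. -/
noncomputable def emb : HahnSeries ℚ≥0ᵒᵈ ℝ →+* HF :=
  HahnSeries.embDomainRingHom ratExp ratExp_injective ratExp_le

theorem emb_coeff (y : HahnSeries ℚ≥0ᵒᵈ ℝ) (q : ℚ≥0ᵒᵈ) : (emb y).coeff (ratExp q) = y.coeff q :=
  HahnSeries.embDomain_coeff (f := ⟨⟨ratExp, ratExp_injective⟩, ratExp_le _ _⟩)

theorem emb_injective : Function.Injective emb :=
  HahnSeries.embDomain_injective (f := ⟨⟨ratExp, ratExp_injective⟩, ratExp_le _ _⟩)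

theorem SI_emb (y : HahnSeries ℚ≥0ᵒᵈ ℝ) : SI (Set.range ratExp) (emb y) := fun _ hq =>
  HahnSeries.embDomain_of_notMem_range (f := ⟨⟨ratExp, ratExp_injective⟩, ratExp_le _ _⟩) hq

theorem exists_emb_eq {y : HF} (h : SI (Set.range ratExp) y) : ∃ z, emb z = y := by
  refine ⟨⟨fun q => y.coeff (ratExp q), fun g => ?_⟩, ?_⟩
  · obtain ⟨m, n, hmn, hle⟩ := y.isPWO_support fun n => ⟨ratExp (g n), (g n).2⟩
    exact ⟨m, n, hmn, (ratExp_le _ _).1 hle⟩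
  · ext q
    by_cases hq : q ∈ Set.range ratExp
    · obtain ⟨q, rfl⟩ := hq
      rw [emb_coeff]
    · rw [SI_emb _ q hq, h q hq]

theorem ratExp_nonpos (q : ℚ≥0ᵒᵈ) : ratExp q ≤ 0 := by
  rw [ratExp_apply, neg_nonpos]; positivity

theorem emb_mem_N0 (y : HahnSeries ℚ≥0ᵒᵈ ℝ) : emb y ∈ N0 :=
  (SI_emb y).mono (Set.range_subset_iff.2 ratExp_nonpos)

theorem mem_range_ratExp {q : ℝ} : q ∈ Set.range ratExp ↔ q ≤ 0 ∧ ∃ r : ℚ, (r : ℝ) = q := by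
  constructor
  · rintro ⟨p, rfl⟩
    exact ⟨ratExp_nonpos p, -(OrderDual.ofDual p : ℚ≥0), by rw [ratExp_apply]; push_cast; rfl⟩
  · rintro ⟨h, r, rfl⟩
    have hr : 0 ≤ -r := by
      have : r ≤ 0 := by exact_mod_cast h
      linarith
    refine ⟨OrderDual.toDual (-r).toNNRat, ?_⟩
    have h1 := congrArg (fun s : ℚ => (s : ℝ)) (Rat.coe_toNNRat _ hr)
    push_cast at h1
    rw [ratExp_apply, OrderDual.ofDual_toDual, h1, neg_neg]

/-- Divisibility by a series with rational exponents descends to such series. -/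
theorem exists_mul_of_emb_eq {x a : HahnSeries ℚ≥0ᵒᵈ ℝ} (hx : x ≠ 0) {e : HF} (he : e ∈ N0)
    (h : emb a = emb x * e) : ∃ e', a = x * e' := by
  set R : Set ℝ := Set.range fun r : ℚ => (r : ℝ) with hR
  have hemb (y : HahnSeries ℚ≥0ᵒᵈ ℝ) : SI R (emb y) := (SI_emb y).mono fun q hq =>
    (mem_range_ratExp.1 hq).2
  have e1 : restr R e + restr Rᶜ e = e := by
    rw [restr_add_restr R Rᶜ Set.univ e (Set.union_compl_self R) fun q hq h' => h' hq]
    ext q; simp [restr_coeff]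
  have h1 : SI R (emb x * restr Rᶜ e) := by
    have e2 : emb x * restr Rᶜ e = emb a + -(emb x * restr R e) := by
      rw [h]; nth_rw 2 [← e1]; ring
    rw [e2]
    refine (hemb a).add fun q hq => ?_
    rw [HahnSeries.coeff_neg, neg_eq_zero]
    refine SI.mul (hemb x) (SI_restr R e) ?_ q hq
    rintro _ ⟨p, rfl⟩ _ ⟨q, rfl⟩
    exact ⟨p + q, by push_cast; rfl⟩
  have h2 : SI Rᶜ (emb x * restr Rᶜ e) := by
    refine SI.mul (hemb x) (SI_restr Rᶜ e) ?_
    rintro _ ⟨p, rfl⟩ q hq ⟨r, hr⟩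
    refine hq ⟨r - p, ?_⟩
    simp only at hr ⊢
    push_cast
    linarith
  have h3 : emb x * restr Rᶜ e = 0 := by
    ext q
    by_cases hq : q ∈ R
    · exact h2 q fun h' => h' hq
    · exact h1 q hq
  have hx' : emb x ≠ 0 := fun h0 => hx (emb_injective (by rw [h0, map_zero]))
  have h4 := (mul_eq_zero.1 h3).resolve_left hx'
  rw [h4, add_zero] at e1
  have h5 : SI (Set.range ratExp) e := by
    rw [← e1]
    exact (SI.restr he).mono fun q hq => mem_range_ratExp.2 ⟨hq.2, hq.1⟩
  obtain ⟨e', rfl⟩ := exists_emb_eq h5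
  exact ⟨e', emb_injective (by rw [h, map_mul])⟩

theorem isSer_emb {x : HahnSeries ℚ≥0ᵒᵈ ℝ}
    (hx : ∀ q : ℚ≥0ᵒᵈ, x.coeff q =
      if OrderDual.ofDual q = 0 ∨ ∃ n : ℕ, 0 < n ∧ OrderDual.ofDual q = 1 / (n : ℚ≥0)
      then 1 else 0) : IsSer (emb x) := by
  intro q
  by_cases hq : q ∈ Set.range ratExp
  · obtain ⟨q, rfl⟩ := hq
    rw [emb_coeff, hx]
    refine if_congr (or_congr ?_ ⟨?_, ?_⟩) rfl rfl
    · rw [ratExp_apply, neg_eq_zero, NNRat.cast_eq_zero]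
    · rintro ⟨n, hn, h⟩
      obtain ⟨n, rfl⟩ := Nat.exists_eq_succ_of_ne_zero hn.ne'
      refine ⟨n, ?_⟩
      rw [ratExp_apply, h]
      push_cast
      rw [neg_div]
    · rintro ⟨n, h⟩
      refine ⟨n + 1, n.succ_pos, ?_⟩
      rw [ratExp_apply, neg_div, neg_inj] at h
      have : ((OrderDual.ofDual q : ℚ≥0) : ℝ) = ((1 / ((n + 1 : ℕ) : ℚ≥0) : ℚ≥0) : ℝ) := by
        rw [h]; push_cast; rfl
      exact_mod_cast this
  · rw [SI_emb x q hq, if_neg]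
    rintro (rfl | ⟨n, rfl⟩)
    · exact hq (mem_range_ratExp.2 ⟨le_rfl, 0, Rat.cast_zero⟩)
    · refine hq (mem_range_ratExp.2 ⟨div_nonpos_of_nonpos_of_nonneg (by norm_num) (by positivity),
        -1 / (n + 1), by push_cast; rfl⟩)

theorem order_nonpos {y : HF} (h : y ∈ N0) (hy : y ≠ 0) : y.order ≤ 0 := by
  by_contra h1
  exact HahnSeries.coeff_order_eq_zero.not.2 hy (h _ h1)

theorem IsSer.mul_ne_one {x y : HF} (hx : IsSer x) (hy : y ∈ N0) : x * y ≠ 1 := by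
  intro h
  have h0 : x * y ≠ 0 := by rw [h]; exact one_ne_zero
  have h1 := HahnSeries.order_mul (left_ne_zero_of_mul h0) (right_ne_zero_of_mul h0)
  have h2 := order_nonpos hy (right_ne_zero_of_mul h0)
  have h3 : x.order ≤ -1 := HahnSeries.order_le_of_coeff_ne_zero (by
    rw [hx, if_pos (Or.inr ⟨0, by norm_num⟩)]; exact one_ne_zero)
  rw [h, HahnSeries.order_one] at h1
  linarith

end HF

/-- Pitteloud's example: in the ring `R = [[ℝ^{ℚ^{≤0}}]]` of generalized power
series with real coefficients and nonpositive rational exponents, the series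
`1 + Σ_{n≥1} t^{-1/n}` is prime.  We realize `ℚ^{≤0}` as the order dual
`ℚ≥0ᵒᵈ` of the nonnegative rationals, an element `q : ℚ≥0ᵒᵈ` standing for the
exponent `-q`; thus the series is the Hahn series whose coefficient is `1` at
the exponents corresponding to `0` and `-1/n` (`n ≥ 1`) and `0` elsewhere. -/
theorem pitteloud_series_prime
    (x : HahnSeries ℚ≥0ᵒᵈ ℝ)
    (hx : ∀ q : ℚ≥0ᵒᵈ,
      x.coeff q =
        if OrderDual.ofDual q = 0 ∨ ∃ n : ℕ, 0 < n ∧ OrderDual.ofDual q = 1 / (n : ℚ≥0)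
        then 1 else 0) :
    Prime x := by
  have hs := HF.isSer_emb hx
  have hx0 : x ≠ 0 := by
    rintro rfl
    have := hx (OrderDual.toDual 0)
    rw [if_pos (Or.inl (OrderDual.ofDual_toDual 0))] at this
    exact zero_ne_one this
  refine ⟨hx0, fun hu => ?_, ?_⟩
  · obtain ⟨y, hy⟩ := hu.exists_right_inv
    refine hs.mul_ne_one (HF.emb_mem_N0 y) ?_
    rw [← map_mul, hy, map_one]
  · rintro a b ⟨c, hc⟩
    have h : HF.emb a * HF.emb b = HF.emb x * HF.emb c := by rw [← map_mul, hc, map_mul]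
    rcases hs.prime (HF.emb_mem_N0 a) (HF.emb_mem_N0 b) (HF.emb_mem_N0 c) h with
      ⟨e, he, h1⟩ | ⟨e, he, h1⟩
    · exact Or.inl (HF.exists_mul_of_emb_eq hx0 he h1)
    · exact Or.inr (HF.exists_mul_of_emb_eq hx0 he h1)
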